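/- arXiv:1103.4019 — 2 statements merged into one kernel-verified Lean document; each statement's English description precedes it below -/
import Mathlib

section
/- (Unzipping tripods.) Let X be a proper L-annularly linearly connected metric space. Let γ' : [0,1] → X be an arc, let U be an arcwise connected open set containing γ'([0,1)), and let α' : [0,1] → X be an arc with α'(0) ∉ U, α'([0,1)) ∩ γ'([0,1]) = ∅, and α'(1) ∈ γ'([0,1]) ∩ U. Then there exist arcs α, γ : [0,1] → X such that: (1a) γ([0,1)) ⊆ U; (1b) γ(1) = γ'(1); (1c) there exists 0 < s₀ ≤ 1 with γ|_{[0,s₀]} = γ'|_{[0,s₀]}; (2a) there exists 0 < t₀ < 1 with α|_{[0,t₀]} = α'|_{[0,t₀]}; (2b) α([t₀,1)) ⊆ U; (2c) α([t₀,1)) ∩ γ([0,1)) = ∅; (2d) α(1) = γ(1) = γ'(1). -/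
open Set Metric

/-- An arc in a metric space: an injective continuous map defined on `[0,1]`. -/
def IsArc {X : Type*} [MetricSpace X] (γ : ℝ → X) : Prop :=
  ContinuousOn γ (Set.Icc 0 1) ∧ Set.InjOn γ (Set.Icc 0 1)

/-- A set `U` is arcwise connected if any two distinct points of `U` are joined by an arc
contained in `U`. -/
def ArcConnected {X : Type*} [MetricSpace X] (U : Set X) : Prop :=
  ∀ x ∈ U, ∀ y ∈ U, x ≠ y →
    ∃ c : ℝ → X, IsArc c ∧ c 0 = x ∧ c 1 = y ∧ c '' Set.Icc 0 1 ⊆ U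

/-- `X` is `L`-annularly linearly connected: (BT) any two points lie in a continuum of
diameter at most `L` times their distance, and (ALC2) for `0 < r`, `2r ≤ R ≤ diam X`, any
two points of `B(x,R) ∖ B(x,r)` are joined by a continuum inside `B(x,LR) ∖ B(x,r/L)`. -/
def IsALC (L : ℝ) (X : Type*) [MetricSpace X] : Prop :=
  (∀ x y : X, ∃ K : Set X, IsCompact K ∧ IsConnected K ∧ x ∈ K ∧ y ∈ K ∧
      Metric.diam K ≤ L * dist x y) ∧
  (∀ (x : X) (r R : ℝ), 0 < r → 2 * r ≤ R →
      ENNReal.ofReal R ≤ EMetric.diam (Set.univ : Set X) →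
      ∀ y ∈ Metric.ball x R \ Metric.ball x r, ∀ z ∈ Metric.ball x R \ Metric.ball x r,
        ∃ K : Set X, IsCompact K ∧ IsConnected K ∧ y ∈ K ∧ z ∈ K ∧
          K ⊆ Metric.ball x (L * R) \ Metric.ball x (r / L))

/-- A finite chain of points from `x` to `y` with steps of length at most `η`, indexed by `ℕ` and
stationary at `y` from the index `N` on. -/
def IsFineChain {X : Type*} [MetricSpace X] (η : ℝ) (N : ℕ) (s : ℕ → X) (x y : X) : Prop :=
  s 0 = x ∧ (∀ k, N ≤ k → s k = y) ∧ ∀ k, dist (s k) (s (k + 1)) ≤ η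

lemma IsPreconnected.exists_isFineChain {X : Type*} [MetricSpace X] {K : Set X}
    (hK : IsPreconnected K) {x y : X} (hx : x ∈ K) (hy : y ∈ K) {η : ℝ} (hη : 0 < η) :
    ∃ N s, IsFineChain η N s x y ∧ ∀ k, s k ∈ K := by
  have key : Relation.ReflTransGen (fun a b => dist a b ≤ η ∧ b ∈ K) x y := by
    refine hK.induction₂' (fun x y => Relation.ReflTransGen (fun a b => dist a b ≤ η ∧ b ∈ K) x y)
      ?_ (fun _ _ _ _ _ _ => Relation.ReflTransGen.trans) hx hy
    intro z hz
    filter_upwards [self_mem_nhdsWithin,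
      mem_nhdsWithin_of_mem_nhds (Metric.ball_mem_nhds z hη)] with w hw hwz
    rw [Metric.mem_ball] at hwz
    exact ⟨.single ⟨by rw [dist_comm]; exact hwz.le, hw⟩, .single ⟨hwz.le, hz⟩⟩
  induction key with
  | refl => exact ⟨0, fun _ => x, ⟨rfl, fun _ _ => rfl, fun _ => by simpa using hη.le⟩, fun _ => hx⟩
  | @tail b c _ hbc ih =>
    obtain ⟨N, s, ⟨h0, hN, hs⟩, hsK⟩ := ih (by
      rename_i h
      rcases Relation.ReflTransGen.cases_tail h with h | ⟨_, _, h⟩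
      · exact h ▸ hx
      · exact h.2)
    refine ⟨N + 1, fun k => if k ≤ N then s k else c, ⟨by simp [h0], fun k hk => ?_, fun k => ?_⟩,
      fun k => ?_⟩
    · simp [show ¬ k ≤ N by omega]
    · rcases lt_trichotomy k N with h | h | h
      · simpa [show k ≤ N by omega, show k + 1 ≤ N by omega] using hs k
      · subst h
        simpa [hN k le_rfl] using hbc.1
      · simpa [show ¬ k ≤ N by omega, show ¬ k + 1 ≤ N by omega] using hη.le
    · dsimp only
      split_ifs
      · exact hsK k
      · exact hbc.2

/-- Linear connectedness: any two points lie in a continuum of comparable diameter. -/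
def IsLinConnected (L : ℝ) (X : Type*) [MetricSpace X] : Prop :=
  ∀ x y : X, ∃ K : Set X, IsCompact K ∧ IsConnected K ∧ x ∈ K ∧ y ∈ K ∧
    Metric.diam K ≤ L * dist x y

lemma IsLinConnected.exists_refinement {X : Type*} [MetricSpace X] {L : ℝ} (hL : 0 ≤ L)
    (hX : IsLinConnected L X) {η η' : ℝ} (hη' : 0 < η') {N : ℕ} {s : ℕ → X}
    {x y : X} (hs : IsFineChain η N s x y) :
    ∃ M s', 0 < M ∧ IsFineChain η' (N * M) s' x y ∧ ∀ i, dist (s' i) (s (i / M)) ≤ L * η := by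
  obtain ⟨h0, hN, hstep⟩ := hs
  have hsub : ∀ k, ∃ n u, IsFineChain η' n u (s k) (s (k + 1)) ∧
      ∀ j, dist (u j) (s k) ≤ L * dist (s k) (s (k + 1)) := by
    intro k
    obtain ⟨K, hKc, hKconn, hxK, hyK, hd⟩ := hX (s k) (s (k + 1))
    obtain ⟨n, u, hu, huK⟩ := hKconn.isPreconnected.exists_isFineChain hxK hyK hη'
    exact ⟨n, u, hu, fun j => (Metric.dist_le_diam_of_mem hKc.isBounded (huK j) hxK).trans hd⟩
  choose n u hu hud using hsub
  have hM : ∃ M, 0 < M ∧ ∀ k j, M ≤ j → u k j = s (k + 1) := by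
    refine ⟨(Finset.range N).sup n + 1, Nat.succ_pos _, fun k j hj => ?_⟩
    by_cases hk : k < N
    · have := Finset.le_sup (f := n) (Finset.mem_range.2 hk)
      exact (hu k).2.1 j (by omega)
    · have := hud k j
      rw [hN k (by omega), hN (k + 1) (by omega), dist_self, mul_zero] at this
      rw [hN (k + 1) (by omega)]
      exact dist_le_zero.1 this
  obtain ⟨M, hM0, hM⟩ := hM
  refine ⟨M, fun i => u (i / M) (i % M), hM0, ⟨?_, fun i hi => ?_, fun i => ?_⟩, fun i => ?_⟩
  · simp [(hu 0).1, h0]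
  · have hk : N ≤ i / M := (Nat.le_div_iff_mul_le hM0).2 hi
    have := hud (i / M) (i % M)
    rw [hN _ hk, hN (i / M + 1) (by omega), dist_self, mul_zero] at this
    exact dist_le_zero.1 this
  · dsimp only
    have h1 := Nat.div_add_mod i M
    have h2 := Nat.mod_lt i hM0
    by_cases h : i % M + 1 = M
    · have e1 : i + 1 = M * (i / M + 1) := by rw [mul_add]; omega
      have e2 : (i + 1) / M = i / M + 1 := by rw [e1, Nat.mul_div_cancel_left _ hM0]
      have e3 : (i + 1) % M = 0 := by rw [e1, Nat.mul_mod_right]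
      rw [e2, e3, (hu (i / M + 1)).1, ← hM (i / M) (i % M + 1) (by omega)]
      exact (hu _).2.2 _
    · have e1 : i + 1 = i % M + 1 + M * (i / M) := by omega
      have e2 : (i + 1) / M = i / M := by
        rw [e1, Nat.add_mul_div_left _ _ hM0, Nat.div_eq_of_lt (by omega), zero_add]
      have e3 : (i + 1) % M = i % M + 1 := by
        rw [e1, Nat.add_mul_mod_self_left, Nat.mod_eq_of_lt (by omega)]
      rw [e2, e3]
      exact (hu _).2.2 _
  · exact (hud _ _).trans (mul_le_mul_of_nonneg_left (hstep _) hL)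

lemma IsFineChain.dist_floor_le {X : Type*} [MetricSpace X] {η : ℝ} {N : ℕ} {s : ℕ → X} {x y : X}
    (hs : IsFineChain η N s x y) (hη : 0 ≤ η) {t t' : ℝ} (htt' : t ≤ t') (h : (t' - t) * N ≤ 1) :
    dist (s ⌊N * t⌋₊) (s ⌊N * t'⌋₊) ≤ η := by
  have h1 : ⌊N * t⌋₊ ≤ ⌊N * t'⌋₊ := Nat.floor_mono (by gcongr)
  have h2 : ⌊N * t'⌋₊ ≤ ⌊N * t⌋₊ + 1 := by
    have : (N : ℝ) * t' ≤ N * t + 1 := by linarith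
    rcases le_or_gt 0 ((N : ℝ) * t) with h0 | h0
    · rw [← Nat.floor_add_one h0]
      exact Nat.floor_mono this
    · exact (Nat.floor_le_one_of_le_one (by linarith)).trans (by omega)
  rcases (show ⌊N * t'⌋₊ = ⌊N * t⌋₊ ∨ ⌊N * t'⌋₊ = ⌊N * t⌋₊ + 1 by omega) with h | h
  · simpa [h] using hη
  · rw [h]; exact hs.2.2 _

lemma IsLinConnected.joinedIn_closedBall {X : Type*} [MetricSpace X] [CompleteSpace X] {L : ℝ}
    (hL : 0 ≤ L) (hX : IsLinConnected L X) {x y : X} {η : ℝ} (hη : 0 < η) (hxy : dist x y ≤ η) :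
    JoinedIn (Metric.closedBall x ((2 * L + 1) * η)) x y := by
  let S := ℕ × (ℕ → X)
  let e : ℕ → ℝ := fun n => η / 2 ^ n
  have he : ∀ n, 0 < e n := fun n => by positivity
  have hnext : ∀ (n : ℕ) (p : S), IsFineChain (e n) p.1 p.2 x y → ∃ q : S,
      IsFineChain (e (n + 1)) q.1 q.2 x y ∧ ∃ M, 0 < M ∧ q.1 = p.1 * M ∧
        ∀ i, dist (q.2 i) (p.2 (i / M)) ≤ L * e n := by
    intro n p hp
    obtain ⟨M, s', hM, hs', hd⟩ := hX.exists_refinement hL (he (n + 1)) hp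
    exact ⟨(p.1 * M, s'), hs', M, hM, rfl, hd⟩
  choose! nx hnx1 hnx2 using hnext
  let p : ℕ → S := fun n => Nat.rec (1, fun k => if k = 0 then x else y) nx n
  have hp : ∀ n, IsFineChain (e n) (p n).1 (p n).2 x y := by
    intro n
    induction n with
    | zero =>
      refine ⟨by simp [p], fun k hk => ?_, fun k => ?_⟩
      · have : 1 ≤ k := hk
        simp [p, show k ≠ 0 by omega]
      · rcases Nat.eq_zero_or_pos k with h | h
        · subst h; simpa [p, e] using hxy
        · simpa [p, show k ≠ 0 by omega] using (he 0).le
    | succ n ih => exact hnx1 n _ ih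
  let f : ℕ → ℝ → X := fun n t => (p n).2 ⌊(p n).1 * t⌋₊
  have hf : ∀ n t, dist (f n t) (f (n + 1) t) ≤ (L * η * 2) / 2 / 2 ^ n := by
    intro n t
    obtain ⟨M, hM, hq, hd⟩ := hnx2 n (p n) (hp n)
    have hM' : (M : ℝ) ≠ 0 := by positivity
    have : ⌊((p n).1 : ℝ) * t⌋₊ = ⌊((p (n + 1)).1 : ℝ) * t⌋₊ / M := by
      rw [← Nat.floor_div_natCast, show (p (n + 1)).1 = (p n).1 * M from hq]
      push_cast
      congr 1
      field_simp
    rw [dist_comm]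
    dsimp only [f]
    rw [this]
    refine (hd _).trans (le_of_eq ?_)
    simp only [e]; ring
  have hcs : ∀ t, CauchySeq fun n => f n t := fun t => cauchySeq_of_le_geometric_two (fun n => hf n t)
  choose g hg using fun t => cauchySeq_tendsto_of_complete (hcs t)
  have hfg : ∀ n t, dist (f n t) (g t) ≤ 2 * L * e n := by
    intro n t
    refine (dist_le_of_le_geometric_two_of_tendsto (fun n => hf n t) (hg t) n).trans (le_of_eq ?_)
    simp only [e]; ring
  have hcont : Continuous g := by
    rw [Metric.continuous_iff]
    intro b ε hε
    obtain ⟨n, hn⟩ : ∃ n : ℕ, (4 * L + 1) * e n < ε := by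
      have : Filter.Tendsto (fun n => (4 * L + 1) * e n) Filter.atTop (nhds ((4 * L + 1) * 0)) := by
        refine Filter.Tendsto.const_mul _ ?_
        have := (tendsto_pow_atTop_nhds_zero_of_lt_one (r := (1 / 2 : ℝ)) (by norm_num)
          (by norm_num)).const_mul η
        simpa [e, div_eq_mul_inv] using this
      rw [mul_zero] at this
      exact (this.eventually (gt_mem_nhds hε)).exists
    refine ⟨1 / ((p n).1 + 1), by positivity, fun a ha => ?_⟩
    have hclose : ∀ t t' : ℝ, t ≤ t' → |t' - t| < 1 / ((p n).1 + 1) →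
        dist (f n t) (f n t') ≤ e n := by
      intro t t' h h'
      refine (hp n).dist_floor_le (he n).le h ?_
      rw [abs_of_nonneg (by linarith), lt_div_iff₀ (by positivity)] at h'
      nlinarith
    have hab : dist (f n a) (f n b) ≤ e n := by
      rw [Real.dist_eq] at ha
      rcases le_total a b with h | h
      · exact hclose a b h (by rwa [abs_sub_comm])
      · rw [dist_comm]; exact hclose b a h ha
    have h1 := hfg n a
    have h2 := hfg n b
    have h3 := dist_triangle4 (g a) (f n a) (f n b) (g b)
    nlinarith [dist_comm (g a) (f n a)]
  have hg0 : g 0 = x := by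
    refine tendsto_nhds_unique (hg 0) ?_
    simp [f, (hp _).1]
  have hg1 : g 1 = y := by
    refine tendsto_nhds_unique (hg 1) ?_
    simp [f, (hp _).2.1]
  refine JoinedIn.ofLine hcont.continuousOn hg0 hg1 ?_
  rintro _ ⟨t, -, rfl⟩
  have h1 : dist x (f 0 t) ≤ η := by
    have hp0 : ∀ k, (p 0).2 k = if k = 0 then x else y := fun _ => rfl
    simp only [f, hp0]
    split_ifs
    · simpa using hη.le
    · exact hxy
  have h2 := hfg 0 t
  rw [Metric.mem_closedBall, dist_comm]
  have : e 0 = η := by simp [e]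
  rw [this] at h2
  linarith [dist_triangle x (f 0 t) (g t)]

lemma IsLinConnected.locallyPathConnectedSpace {X : Type*} [MetricSpace X] [CompleteSpace X]
    {L : ℝ} (hL : 0 ≤ L) (hX : IsLinConnected L X) : LocallyPathConnectedSpace X where
  path_connected_basis x := by
    rw [Filter.hasBasis_self]
    intro u hu
    obtain ⟨ε, hε, hεu⟩ := Metric.nhds_basis_closedBall.mem_iff.1 hu
    have hpos : 0 < 2 * L + 1 := by linarith
    refine ⟨pathComponentIn u x, ?_, isPathConnected_pathComponentIn (mem_of_mem_nhds hu),
      pathComponentIn_subset⟩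
    refine Filter.mem_of_superset (Metric.closedBall_mem_nhds x (div_pos hε hpos)) fun y hy => ?_
    refine (hX.joinedIn_closedBall hL (div_pos hε hpos)
      (by rw [dist_comm]; exact hy)).mono ?_
    rwa [mul_div_cancel₀ _ hpos.ne']

lemma IsConnected.joinedIn_of_isOpen {X : Type*} [TopologicalSpace X] [LocallyPathConnectedSpace X]
    {K G : Set X} (hK : IsConnected K) (hG : IsOpen G) (hKG : K ⊆ G) {x y : X} (hx : x ∈ K)
    (hy : y ∈ K) : JoinedIn G x y := by
  have h1 : IsOpen (connectedComponentIn G x) := hG.connectedComponentIn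
  have h2 : IsPathConnected (connectedComponentIn G x) :=
    h1.isConnected_iff_isPathConnected.1 (isConnected_connectedComponentIn_iff.2 (hKG hx))
  exact (h2.joinedIn x (mem_connectedComponentIn (hKG hx)) y
    (hK.isPreconnected.subset_connectedComponentIn hx hKG hy)).mono
    (connectedComponentIn_subset _ _)

/-- A closed subset of `[0, 1]` containing the endpoints, such that `f` takes the same value at both
ends of each complementary interval. -/
def IsSkeleton {X : Type*} (f : ℝ → X) (A : Set ℝ) : Prop :=
  A ⊆ Icc 0 1 ∧ IsClosed A ∧ 0 ∈ A ∧ 1 ∈ A ∧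
    ∀ a ∈ A, ∀ b ∈ A, a < b → (∀ z ∈ A, z ∉ Ioo a b) → f a = f b

lemma IsSkeleton.sInter {X : Type*} [MetricSpace X] {f : ℝ → X} (hf : Continuous f)
    {c : Set (Set ℝ)} (hc : ∀ A ∈ c, IsSkeleton f A) (hchain : IsChain (· ⊆ ·) c)
    (hne : c.Nonempty) : IsSkeleton f (⋂₀ c) := by
  refine ⟨(sInter_subset_of_mem hne.some_mem).trans (hc _ hne.some_mem).1,
    isClosed_sInter fun A hA => (hc A hA).2.1, fun A hA => (hc A hA).2.2.1,
    fun A hA => (hc A hA).2.2.2.1, fun a ha b hb hab hgap => ?_⟩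
  refine eq_of_forall_dist_le fun ε hε => ?_
  obtain ⟨δ₁, hδ₁, h₁⟩ := Metric.continuous_iff.1 hf a (ε / 2) (by positivity)
  obtain ⟨δ₂, hδ₂, h₂⟩ := Metric.continuous_iff.1 hf b (ε / 2) (by positivity)
  obtain ⟨δ, hδ, hδ1, hδ2, hδ3⟩ : ∃ δ > 0, δ < δ₁ ∧ δ < δ₂ ∧ δ < (b - a) / 2 := by
    refine ⟨min (min δ₁ δ₂) ((b - a) / 2) / 2, ?_, ?_, ?_, ?_⟩
    · have : 0 < (b - a) / 2 := by linarith
      positivity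
    all_goals
      have : 0 < (b - a) / 2 := by linarith
      have h0 : 0 < min (min δ₁ δ₂) ((b - a) / 2) := by positivity
      have h1 := min_le_left (min δ₁ δ₂) ((b - a) / 2)
      have h2 := min_le_right (min δ₁ δ₂) ((b - a) / 2)
      have h3 := min_le_left δ₁ δ₂
      have h4 := min_le_right δ₁ δ₂
      linarith
  have : Nonempty c := hne.to_subtype
  obtain ⟨⟨A, hAc⟩, hA⟩ := (isCompact_Icc (a := a + δ) (b := b - δ)).elim_directed_family_closed
    (fun A : c => (A : Set ℝ)) (fun A => (hc A A.2).2.1)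
    (by
      rw [← sInter_eq_iInter, eq_empty_iff_forall_notMem]
      rintro z ⟨hz, hzc⟩
      exact hgap z hzc ⟨by linarith [hz.1], by linarith [hz.2]⟩)
    (by
      rintro ⟨A, hA⟩ ⟨B, hB⟩
      rcases hchain.total hA hB with h | h
      · exact ⟨⟨A, hA⟩, subset_rfl, h⟩
      · exact ⟨⟨B, hB⟩, h, subset_rfl⟩)
  obtain ⟨hA01, hAcl, -, -, hAgap⟩ := hc A hAc
  have hAcomp : IsCompact A := isCompact_Icc.of_isClosed_subset hAcl hA01
  obtain ⟨a', ⟨ha'A, ha'⟩, ha'max⟩ := (hAcomp.inter_right (isClosed_Iic (a := a + δ))).exists_isGreatest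
    ⟨a, ha A hAc, by simp [hδ.le]⟩
  obtain ⟨b', ⟨hb'A, hb'⟩, hb'min⟩ := (hAcomp.inter_right (isClosed_Ici (a := b - δ))).exists_isLeast
    ⟨b, hb A hAc, by simp [hδ.le]⟩
  have haa' : a ≤ a' := ha'max ⟨ha A hAc, by simp [hδ.le]⟩
  have hbb' : b' ≤ b := hb'min ⟨hb A hAc, by simp [hδ.le]⟩
  rw [mem_Iic] at ha'
  rw [mem_Ici] at hb'
  have heq : f a' = f b' := by
    refine hAgap a' ha'A b' hb'A (by linarith) fun z hz hz' => ?_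
    rcases le_or_gt z (a + δ) with h | h
    · exact absurd (ha'max ⟨hz, h⟩) (not_le.2 hz'.1)
    rcases le_or_gt (b - δ) z with h' | h'
    · exact absurd (hb'min ⟨hz, h'⟩) (not_le.2 hz'.2)
    · exact (eq_empty_iff_forall_notMem.1 hA) z ⟨⟨h.le, h'.le⟩, hz⟩
  have e1 := h₁ a' (by rw [Real.dist_eq, abs_of_nonneg (by linarith)]; linarith)
  have e2 := h₂ b' (by rw [Real.dist_eq, abs_of_nonpos (by linarith)]; linarith)
  have := dist_triangle (f a) (f a') (f b)
  rw [heq] at this e1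
  rw [dist_comm] at e1
  linarith

/-- A minimal skeleton does not contain points strictly between two points with the same value. -/
lemma IsSkeleton.exists_minimal {X : Type*} [MetricSpace X] {f : ℝ → X} (hf : Continuous f) :
    ∃ A, IsSkeleton f A ∧ ∀ x ∈ A, ∀ y ∈ A, f x = f y → ∀ z ∈ A, z ∉ Ioo x y := by
  obtain ⟨A, -, hA, hmin⟩ := zorn_superset_nonempty {A | IsSkeleton f A}
    (fun c hc hchain hne => ⟨⋂₀ c, IsSkeleton.sInter hf hc hchain hne,
      fun s hs => sInter_subset_of_mem hs⟩) (Icc 0 1)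
    ⟨subset_rfl, isClosed_Icc, by simp, by simp, fun a ha b hb hab h =>
      absurd ⟨by linarith, by linarith⟩ (h ((a + b) / 2)
        ⟨by linarith [ha.1, hb.1], by linarith [ha.2, hb.2]⟩)⟩
  refine ⟨A, hA, fun x hx y hy hxy z hz hzxy => ?_⟩
  obtain ⟨h01, hcl, h0, h1, hgap⟩ := hA
  have hx' := h01 hx
  have hy' := h01 hy
  have : IsSkeleton f (A \ Ioo x y) := by
    refine ⟨sdiff_subset.trans h01, hcl.sdiff isOpen_Ioo, ⟨h0, fun h => ?_⟩, ⟨h1, fun h => ?_⟩,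
      fun a ha b hb hab h => ?_⟩
    · linarith [h.1, hx'.1]
    · linarith [h.2, hy'.2]
    · by_cases hex : ∀ w ∈ A, w ∉ Ioo a b
      · exact hgap a ha.1 b hb.1 hab hex
      push Not at hex
      obtain ⟨w, hw, hwab⟩ := hex
      have hwxy : w ∈ Ioo x y := by
        by_contra hcon
        exact h w ⟨hw, hcon⟩ hwab
      have hxa : x ≤ a := by
        by_contra! hcon
        exact h x ⟨hx, fun h => lt_irrefl _ h.1⟩ ⟨hcon, hwxy.1.trans hwab.2⟩
      have hyb : b ≤ y := by
        by_contra! hcon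
        exact hb.2 ⟨hxa.trans_lt hab, by
          by_contra! hcon'
          exact h y ⟨hy, fun h => lt_irrefl _ h.2⟩ ⟨hwab.1.trans hwxy.2, hcon⟩⟩
      have hax : a ≤ x := by
        by_contra! hcon
        exact ha.2 ⟨hcon, hab.trans_le hyb⟩
      have hby : y ≤ b := by
        by_contra! hcon
        exact hb.2 ⟨hxa.trans_lt hab, hcon⟩
      rw [le_antisymm hax hxa, le_antisymm hyb hby, hxy]
  exact (hmin this sdiff_subset hz).2 hzxy

/-- Loop erasure: the image of a path contains a path with the same endpoints all of whose fibres
are intervals. -/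
lemma exists_path_isInterval_fibre {X : Type*} [MetricSpace X] {f : ℝ → X} (hf : Continuous f) :
    ∃ g : ℝ → X, Continuous g ∧ g 0 = f 0 ∧ g 1 = f 1 ∧ (∀ t, g t ∈ f '' Icc 0 1) ∧
      ∀ s u t, s ≤ u → u ≤ t → g s = g t → g u = g s := by
  obtain ⟨A, ⟨h01, hcl, h0, h1, hgap⟩, hA⟩ := IsSkeleton.exists_minimal hf
  have hAcomp : IsCompact A := isCompact_Icc.of_isClosed_subset hcl h01
  have hr : ∀ t : ℝ, ∃ r, IsGreatest (A ∩ Iic (max t 0)) r := fun t =>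
    (hAcomp.inter_right isClosed_Iic).exists_isGreatest ⟨0, h0, by simp⟩
  choose r hr using hr
  have hrA : ∀ t, r t ∈ A := fun t => (hr t).1.1
  have hrmono : Monotone r := fun s t hst => (hr t).2
    ⟨hrA s, (hr s).1.2.trans (max_le_max_right _ hst)⟩
  refine ⟨fun t => f (r t), ?_, ?_, ?_, fun t => ⟨r t, h01 (hrA t), rfl⟩, ?_⟩
  · have huc := (isCompact_Icc (a := (0 : ℝ)) (b := 1)).uniformContinuousOn_of_continuous
      hf.continuousOn
    rw [Metric.uniformContinuousOn_iff] at huc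
    have key : ∀ s t, s ≤ t → ∃ s' ∈ Icc (0 : ℝ) 1, f (r s) = f s' ∧ |s' - r t| ≤ t - s := by
      intro s t hst
      rcases (hrmono hst).eq_or_lt with h | h
      · exact ⟨r t, h01 (hrA t), by rw [h], by simpa using hst⟩
      have hrt : max s 0 < r t := by
        by_contra! hcon
        exact absurd ((hr s).2 ⟨hrA t, hcon⟩) (not_le.2 h)
      have ht0 : 0 < t := by
        by_contra! hcon
        have := (hr t).1.2
        rw [mem_Iic, max_eq_right hcon] at this
        exact absurd (hrt.trans_le this) (not_lt.2 (le_max_right _ _))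
      obtain ⟨p, ⟨hpA, hp⟩, hpmin⟩ := (hAcomp.inter_right (isClosed_Ici (a := max s 0))).exists_isLeast
        ⟨r t, hrA t, hrt.le⟩
      have hp' : p ≤ r t := hpmin ⟨hrA t, hrt.le⟩
      refine ⟨p, h01 hpA, ?_, ?_⟩
      · have hle : r s ≤ p := (hr s).1.2.trans hp
        rcases hle.eq_or_lt with h' | h'
        · rw [h']
        refine hgap _ (hrA s) _ hpA h' fun z hz hz' => ?_
        rcases le_total z (max s 0) with h'' | h''
        · exact absurd ((hr s).2 ⟨hz, h''⟩) (not_le.2 hz'.1)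
        · exact absurd (hpmin ⟨hz, h''⟩) (not_le.2 hz'.2)
      · have h2 := (hr t).1.2
        rw [mem_Iic, max_eq_left ht0.le] at h2
        rw [mem_Ici, max_le_iff] at hp
        rw [abs_of_nonpos (by linarith)]
        linarith [hp.1]
    rw [Metric.continuous_iff]
    intro b ε hε
    obtain ⟨δ, hδ, h⟩ := huc ε hε
    have key2 : ∀ s t, s ≤ t → |s - t| < δ → dist (f (r s)) (f (r t)) < ε := by
      intro s t hst hd
      obtain ⟨s', hs', he, hle⟩ := key s t hst
      rw [he]
      refine h s' hs' (r t) (h01 (hrA t)) (lt_of_le_of_lt (hle.trans ?_) hd)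
      rw [abs_sub_comm]; exact le_abs_self _
    refine ⟨δ, hδ, fun a ha => ?_⟩
    rw [Real.dist_eq] at ha
    rcases le_total a b with hab | hab
    · exact key2 a b hab ha
    · rw [dist_comm]; exact key2 b a hab (by rwa [abs_sub_comm])
  · have : r 0 = 0 := le_antisymm (by simpa using (hr 0).1.2) (h01 (hrA 0)).1
    simp [this]
  · have : r 1 = 1 := le_antisymm (h01 (hrA 1)).2 ((hr 1).2 ⟨h1, by simp⟩)
    simp [this]
  · intro s u t hsu hut hst
    have h := hA _ (hrA s) _ (hrA t) hst (r u) (hrA u)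
    rcases (hrmono hsu).eq_or_lt with h' | h'
    · simp [h']
    rcases (hrmono hut).eq_or_lt with h'' | h''
    · simp only [h'', hst]
    · exact absurd ⟨h', h''⟩ h

/-- A monotone change of parameter collapsing exactly the intervals on which `g` is constant. -/
lemma exists_monotone_collapse {X : Type*} [MetricSpace X] {g : ℝ → X} (hg : Continuous g)
    {C : ℝ} (hC : ∀ s t, dist (g s) (g t) ≤ C)
    (hfib : ∀ s u t, s ≤ u → u ≤ t → g s = g t → g u = g s) :
    ∃ φ : ℝ → ℝ, Continuous φ ∧ Monotone φ ∧ ∀ s t, φ s = φ t ↔ g s = g t := by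
  let D : ℝ → ℝ → ℝ := fun p x =>
    sSup ((fun t => dist (g p) (g (p + t * max (x - p) 0))) '' Icc 0 1)
  have hbdd : ∀ p x, BddAbove ((fun t => dist (g p) (g (p + t * max (x - p) 0))) '' Icc 0 1) :=
    fun p x => ⟨C, by rintro _ ⟨t, -, rfl⟩; exact hC _ _⟩
  have hDcont : ∀ p, Continuous (D p) := fun p =>
    (isCompact_Icc (a := (0 : ℝ)) (b := 1)).continuous_sSup
      (f := fun x t => dist (g p) (g (p + t * max (x - p) 0))) (by
        have : Continuous fun q : ℝ × ℝ => dist (g p) (g (p + q.2 * max (q.1 - p) 0)) := by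
          fun_prop
        exact this)
  have hle : ∀ p x z, p ≤ z → z ≤ max x p → dist (g p) (g z) ≤ D p x := by
    intro p x z hpz hzx
    rcases hpz.eq_or_lt with rfl | hpz
    · exact le_csSup (hbdd _ _) ⟨0, by simp, by simp⟩
    have hx : p < x := by
      rcases le_max_iff.1 hzx with h | h <;> linarith
    rw [max_eq_left hx.le] at hzx
    refine le_csSup (hbdd _ _) ⟨(z - p) / (x - p), ⟨div_nonneg (by linarith) (by linarith),
      (div_le_one (by linarith)).2 (by linarith)⟩, ?_⟩
    have : x - p ≠ 0 := by linarith
    simp only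
    rw [max_eq_left (by linarith), div_mul_cancel₀ _ this, add_sub_cancel]
  have hge : ∀ p x B, (∀ z, p ≤ z → z ≤ max x p → dist (g p) (g z) ≤ B) → D p x ≤ B := by
    intro p x B h
    refine csSup_le ((nonempty_Icc.2 zero_le_one).image _) ?_
    rintro _ ⟨t, ht, rfl⟩
    have h0 : 0 ≤ max (x - p) 0 := le_max_right _ _
    refine h _ (by linarith [mul_nonneg ht.1 h0]) ?_
    have h1 : max (x - p) 0 = max x p - p := by
      rw [← max_sub_sub_right, sub_self]
    have h2 := mul_le_of_le_one_left h0 ht.2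
    linarith
  have hD0 : ∀ p x, 0 ≤ D p x := fun p x => dist_nonneg.trans (hle p x p le_rfl (le_max_right _ _))
  have hDC : ∀ p x, D p x ≤ C := fun p x => hge p x C fun _ _ _ => hC _ _
  have hDmono : ∀ p, Monotone (D p) := fun p x y hxy =>
    hge p x _ fun z hz hz' => hle p y z hz (hz'.trans (max_le_max_right _ hxy))
  have hDeq : ∀ p s t, s ≤ t → g s = g t → D p t ≤ D p s := by
    intro p s t hst he
    refine hge p t _ fun z hz hz' => ?_
    rcases le_or_gt z (max s p) with h | h
    · exact hle p s z hz h
    have hsz : s < z := (le_max_left _ _).trans_lt h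
    have hpz : p < z := (le_max_right _ _).trans_lt h
    have hzt : z ≤ t := by
      rcases le_max_iff.1 hz' with h | h <;> linarith
    rw [hfib s z t hsz.le hzt he]
    rcases le_total p s with hps | hps
    · exact hle p s s hps (le_max_left _ _)
    · rw [hfib s p t hps (by linarith) he, dist_self]; exact hD0 _ _
  let q : ℕ → ℝ := TopologicalSpace.denseSeq ℝ
  have hsum : ∀ x, Summable fun n => (1 / 2 : ℝ) ^ n * D (q n) x := fun x =>
    Summable.of_nonneg_of_le (fun n => mul_nonneg (by positivity) (hD0 _ _))
      (fun n => mul_le_mul_of_nonneg_left (hDC _ _) (by positivity))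
      (summable_geometric_two.mul_right C)
  let φ : ℝ → ℝ := fun x => ∑' n, (1 / 2 : ℝ) ^ n * D (q n) x
  have hmono : Monotone φ := fun x y hxy =>
    (hsum x).tsum_le_tsum (fun n => mul_le_mul_of_nonneg_left (hDmono _ hxy) (by positivity)) (hsum y)
  have hlt : ∀ s t, s < t → g s ≠ g t → φ s < φ t := by
    intro s t hst hne
    have hop : IsOpen {p | g p ≠ g t} := isOpen_ne_fun hg continuous_const
    obtain ⟨ε, hε, hball⟩ := Metric.isOpen_iff.1 hop s hne
    obtain ⟨_, ⟨n, rfl⟩, hp1, hp2⟩ := (TopologicalSpace.denseRange_denseSeq ℝ).exists_between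
      (show s < min t (s + ε) by simp [hst, hε])
    have hp3 := lt_min_iff.1 hp2
    refine Summable.tsum_lt_tsum (i := n)
      (fun m => mul_le_mul_of_nonneg_left (hDmono _ hst.le) (by positivity)) ?_ (hsum s) (hsum t)
    refine mul_lt_mul_of_pos_left ?_ (by positivity)
    have h1 : D (q n) s ≤ 0 := hge _ _ _ fun z hz hz' => by
      rw [max_eq_right hp1.le] at hz'
      rw [le_antisymm hz' hz, dist_self]
    have h2 : 0 < dist (g (q n)) (g t) := dist_pos.2 (hball (by
      rw [Metric.mem_ball, Real.dist_eq, abs_of_nonneg (sub_nonneg.2 hp1.le)]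
      linarith [hp3.2]))
    exact h1.trans_lt (h2.trans_le (hle _ _ _ hp3.1.le (le_max_left _ _)))
  have heq : ∀ s t, s ≤ t → (φ s = φ t ↔ g s = g t) := by
    intro s t hst
    refine ⟨fun h => ?_, fun h => le_antisymm (hmono hst) ?_⟩
    · by_contra hne
      rcases hst.eq_or_lt with rfl | hst
      · exact hne rfl
      · exact (hlt s t hst hne).ne h
    · exact (hsum t).tsum_le_tsum
        (fun n => mul_le_mul_of_nonneg_left (hDeq _ _ _ hst h) (by positivity)) (hsum s)
  refine ⟨φ, ?_, hmono, fun s t => ?_⟩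
  · refine continuous_tsum (u := fun n => (1 / 2 : ℝ) ^ n * C)
      (fun n => continuous_const.mul (hDcont _)) (summable_geometric_two.mul_right C) fun n x => ?_
    rw [Real.norm_of_nonneg (mul_nonneg (by positivity) (hD0 _ _))]
    exact mul_le_mul_of_nonneg_left (hDC _ _) (by positivity)
  · rcases le_total s t with h | h
    · exact heq s t h
    · rw [eq_comm, heq t s h, eq_comm]

lemma JoinedIn.exists_isArc {X : Type*} [MetricSpace X] {F : Set X} {x y : X}
    (h : JoinedIn F x y) (hxy : x ≠ y) :
    ∃ c : ℝ → X, IsArc c ∧ c 0 = x ∧ c 1 = y ∧ c '' Icc 0 1 ⊆ F := by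
  obtain ⟨γ, hγ⟩ := h
  obtain ⟨g, hg, hg0, hg1, hgim, hfib⟩ := exists_path_isInterval_fibre γ.continuous_extend
  rw [γ.extend_zero] at hg0
  rw [γ.extend_one] at hg1
  have hgF : ∀ t, g t ∈ F := fun t => by
    obtain ⟨u, hu, h⟩ := hgim t
    rw [← h, γ.extend_apply hu]
    exact hγ _
  have hbdd : Bornology.IsBounded (γ.extend '' Icc 0 1) :=
    (isCompact_Icc.image γ.continuous_extend).isBounded
  obtain ⟨φ, hφ, hmono, hφg⟩ := exists_monotone_collapse hg
    (fun s t => Metric.dist_le_diam_of_mem hbdd (hgim s) (hgim t)) hfib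
  have h01 : φ 0 < φ 1 := (hmono zero_le_one).lt_of_ne fun h => hxy (by
    rw [← hg0, ← hg1]; exact (hφg 0 1).1 h)
  have hpos : 0 < φ 1 - φ 0 := sub_pos.2 h01
  have hsurj : ∀ u : ℝ, u ∈ Icc (0 : ℝ) 1 → ∃ t ∈ Icc (0 : ℝ) 1, φ t = φ 0 + u * (φ 1 - φ 0) := by
    intro u hu
    have := intermediate_value_Icc (zero_le_one' ℝ) hφ.continuousOn
    exact this ⟨by nlinarith [hu.1], by nlinarith [hu.2]⟩
  choose! τ hτ hφτ using hsurj
  have hc : ∀ u ∈ Icc (0 : ℝ) 1, ∀ t, φ t = φ 0 + u * (φ 1 - φ 0) → g (τ u) = g t :=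
    fun u hu t ht => (hφg _ _).1 ((hφτ u hu).trans ht.symm)
  refine ⟨fun u => g (τ u), ⟨?_, ?_⟩, ?_, ?_, ?_⟩
  · let ψ : Icc (0 : ℝ) 1 → Icc (0 : ℝ) 1 := fun t => ⟨(φ t - φ 0) / (φ 1 - φ 0),
      div_nonneg (sub_nonneg.2 (hmono t.2.1)) hpos.le,
      (div_le_one hpos).2 (sub_le_sub_right (hmono t.2.2) _)⟩
    have hψ : Continuous ψ := by
      refine Continuous.subtype_mk ?_ _
      fun_prop
    have hψs : Function.Surjective ψ := fun u => ⟨⟨τ u, hτ u u.2⟩, Subtype.ext (by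
      simp only [ψ]
      rw [hφτ u u.2]
      field_simp
      ring)⟩
    have hq : Topology.IsQuotientMap ψ := hψ.isClosedMap.isQuotientMap hψ hψs
    rw [continuousOn_iff_continuous_domRestrict, hq.continuous_iff]
    have : (Icc (0 : ℝ) 1).domRestrict (fun u => g (τ u)) ∘ ψ = fun t : Icc (0 : ℝ) 1 => g t := by
      funext t
      refine hc (ψ t) (ψ t).2 t ?_
      simp only [ψ]
      field_simp
      ring
    rw [this]
    exact hg.comp continuous_subtype_val
  · intro u hu v hv huv
    have := (hφg _ _).2 huv
    rw [hφτ u hu, hφτ v hv] at this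
    exact mul_right_cancel₀ hpos.ne' (add_left_cancel this)
  · exact (hc 0 (by simp) 0 (by ring)).trans hg0
  · exact (hc 1 (by simp) 1 (by ring)).trans hg1
  · rintro _ ⟨u, -, rfl⟩
    exact hgF _

/-- Concatenation of infinitely many paths shrinking to a point. -/
lemma JoinedIn.of_seq {X : Type*} [MetricSpace X] {F : Set X} {S : ℕ → Set X} {x : ℕ → X} {e : X}
    (h : ∀ n, JoinedIn (S n) (x n) (x (n + 1))) (hS : ∀ n, S n ⊆ F) (he : e ∈ F)
    (hlim : ∀ ε > 0, ∃ N, ∀ n, N ≤ n → S n ⊆ Metric.ball e ε) : JoinedIn F (x 0) e := by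
  let p : ℕ → ℝ → X := fun n => (h n).somePath.extend
  have hp : ∀ n, Continuous (p n) := fun n => (h n).somePath.continuous_extend
  have hpS : ∀ n t, p n t ∈ S n := fun n t => by
    have : p n t ∈ range (h n).somePath := by
      rw [← Path.extend_range]; exact mem_range_self t
    obtain ⟨u, hu⟩ := this
    rw [← hu]
    exact (h n).somePath_mem u
  let g : ℕ → ℝ → X := fun n => Nat.rec (fun _ => x 0)
    (fun n gn t => if t ≤ n then gn t else p n (t - n)) n
  have hgsucc : ∀ n t, g (n + 1) t = if t ≤ n then g n t else p n (t - n) := fun _ _ => rfl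
  have hgend : ∀ (n : ℕ) (t : ℝ), n ≤ t → g n t = x n := by
    intro n t hnt
    cases n with
    | zero => rfl
    | succ n =>
      push_cast at hnt
      rw [hgsucc, if_neg (by linarith)]
      exact (h n).somePath.extend_of_one_le (by linarith)
  have hgcont : ∀ n, Continuous (g n) := by
    intro n
    induction n with
    | zero => exact continuous_const
    | succ n ih =>
      refine Continuous.if_le ih ((hp n).comp (continuous_id.sub continuous_const)) continuous_id
        continuous_const fun t ht => ?_
      have ht : t = n := ht
      exact (hgend n t ht.ge).trans (by rw [ht]; simp [p])
  have hgle : ∀ (n : ℕ) (t : ℝ), t ≤ n → ∀ k, g (n + k) t = g n t := by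
    intro n t ht k
    induction k with
    | zero => rfl
    | succ k ih =>
      rw [← add_assoc, hgsucc, if_pos (by push_cast; linarith [(Nat.cast_nonneg k : (0 : ℝ) ≤ k)]), ih]
  let f : ℝ → X := fun t => g ⌈t⌉₊ t
  have hfg : ∀ (n : ℕ) (t : ℝ), t ≤ n → f t = g n t := by
    intro n t ht
    have h1 : ⌈t⌉₊ ≤ n := Nat.ceil_le.2 ht
    have h2 := hgle ⌈t⌉₊ t (Nat.le_ceil t) (n - ⌈t⌉₊)
    rw [Nat.add_sub_cancel' h1] at h2
    exact h2.symm
  have hfcont : Continuous f := by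
    rw [continuous_iff_continuousAt]
    intro t
    obtain ⟨n, hn⟩ := exists_nat_gt t
    refine (hgcont n).continuousAt.congr ?_
    filter_upwards [Iio_mem_nhds hn] with s hs
    exact (hfg n s (le_of_lt hs)).symm
  have hfS : ∀ (N : ℕ) (t : ℝ), N < t → ∃ n, N ≤ n ∧ f t ∈ S n := by
    intro N t hNt
    have ht : 0 < t := (Nat.cast_nonneg N).trans_lt hNt
    obtain ⟨n, hn⟩ := Nat.exists_eq_succ_of_ne_zero (Nat.ceil_pos.2 ht).ne'
    have h1 : (n : ℝ) < t := Nat.lt_ceil.1 (by omega)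
    have h2 : N < n + 1 := by
      rw [← Nat.succ_eq_add_one, ← hn]; exact Nat.lt_ceil.2 hNt
    refine ⟨n, by omega, ?_⟩
    simp only [f]
    rw [hn, hgsucc, if_neg (by linarith)]
    exact hpS _ _
  have hfF : ∀ t, f t ∈ F := by
    intro t
    rcases le_or_gt t 0 with ht | ht
    · rw [hfg 0 t (by simpa using ht)]
      exact hS 0 (h 0).source_mem
    · obtain ⟨n, -, hn⟩ := hfS 0 t (by simpa using ht)
      exact hS n hn
  refine JoinedIn.ofLine (f := fun u => if u < 1 then f (1 / (1 - u) - 1) else e) ?_ ?_ ?_ ?_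
  · intro u hu
    rcases hu.2.lt_or_eq with hu1 | rfl
    · refine ContinuousAt.continuousWithinAt ?_
      have h1 : ContinuousAt (fun u : ℝ => 1 / (1 - u) - 1) u :=
        (continuousAt_const.div (continuousAt_const.sub continuousAt_id)
          (sub_ne_zero.2 hu1.ne')).sub continuousAt_const
      refine (hfcont.continuousAt.comp h1).congr ?_
      filter_upwards [Iio_mem_nhds hu1] with v hv
      simp only [Function.comp, if_pos (show v < 1 from hv)]
    · rw [Metric.continuousWithinAt_iff]
      intro ε hε
      obtain ⟨N, hN⟩ := hlim ε hε
      refine ⟨1 / (N + 1), by positivity, fun {v} hv hvd => ?_⟩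
      simp only [lt_irrefl, if_false]
      split_ifs with hv1
      · rw [Real.dist_eq, abs_of_nonpos (by linarith)] at hvd
        have h1 : (N : ℝ) < 1 / (1 - v) - 1 := by
          rw [lt_sub_iff_add_lt, lt_one_div (by positivity) (by linarith)]
          linarith
        obtain ⟨n, hn, hfn⟩ := hfS N _ h1
        exact hN n hn hfn
      · simpa using hε
  · simp only [zero_lt_one, if_true]
    rw [hfg 0 (1 / (1 - 0) - 1) (by simp)]
    exact hgend 0 (1 / (1 - 0) - 1) (by simp)
  · simp
  · rintro _ ⟨u, -, rfl⟩
    dsimp only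
    split_ifs
    · exact hfF _
    · exact he

/-- In an annularly linearly connected proper space, two points at the same suitable distance from
`q` are joined by a path in a round annulus around `q`. -/
lemma IsALC.joinedIn_annulus {X : Type*} [MetricSpace X] [ProperSpace X] {L : ℝ} (hL : 1 ≤ L)
    (h : IsALC L X) {q e y z : X} {ρ : ℝ} (hρ : 0 < ρ) (hqe : ρ ≤ dist e q)
    (hy : dist y q = 3 / 4 * (ρ / L)) (hz : dist z q = 3 / 4 * (ρ / L)) :
    JoinedIn (ball q ρ \ closedBall q (ρ / (4 * L ^ 2))) y z := by
  have hL0 : 0 < L := by linarith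
  have : LocallyPathConnectedSpace X :=
    IsLinConnected.locallyPathConnectedSpace hL0.le (show IsLinConnected L X from h.1)
  have hR : 0 < ρ / L := by positivity
  have hRρ : ρ / L ≤ ρ := div_le_self hρ.le hL
  have hdiam : ENNReal.ofReal (ρ / L) ≤ ediam (univ : Set X) := by
    refine le_trans ?_ (edist_le_ediam_of_mem (mem_univ e) (mem_univ q))
    rw [edist_dist]
    exact ENNReal.ofReal_le_ofReal (hRρ.trans hqe)
  have hmem : ∀ w, dist w q = 3 / 4 * (ρ / L) → w ∈ ball q (ρ / L) \ ball q (ρ / L / 2) := by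
    intro w hw
    simp only [mem_sdiff, mem_ball, hw, not_lt]
    constructor <;> linarith
  obtain ⟨K, -, hK, hyK, hzK, hKsub⟩ := h.2 q (ρ / L / 2) (ρ / L) (by positivity) (by linarith)
    hdiam y (hmem y hy) z (hmem z hz)
  refine hK.joinedIn_of_isOpen (isOpen_ball.sdiff isClosed_closedBall) (fun w hw => ?_) hyK hzK
  obtain ⟨h1, h2⟩ := hKsub hw
  rw [mul_div_cancel₀ _ hL0.ne'] at h1
  refine ⟨h1, fun h3 => h2 (lt_of_le_of_lt (mem_closedBall.1 h3) ?_)⟩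
  have h4 : ρ / L / 2 / L = ρ / (4 * L ^ 2) * 2 := by field_simp; norm_num
  have h5 : 0 < ρ / (4 * L ^ 2) := by positivity
  rw [h4]; linarith

/-- A simple path `g` on `[0,1]` whose part over `[c,1)` lies in the open set `V`, while its
endpoint does not. -/
structure IsSpine {X : Type*} [MetricSpace X] (g : ℝ → X) (V : Set X) (c : ℝ) : Prop where
  cont : Continuous g
  inj : InjOn g (Icc 0 1)
  isOpen : IsOpen V
  nonneg : 0 ≤ c
  mem : ∀ u ∈ Ico c 1, g u ∈ V
  end_notMem : g 1 ∉ V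

/-- Two legs `A` on `[0,l]` and `B` on `[0,m]`, running inside `V` except for their starting points
`a` and `b`, which meet each other and the remaining part `g [s,1]` of the spine only at `g s`. -/
structure IsTripod {X : Type*} [MetricSpace X] (g : ℝ → X) (V : Set X) (a b : X) (A B : ℝ → X)
    (l m s : ℝ) : Prop where
  contA : Continuous A
  contB : Continuous B
  nonnegA : 0 ≤ l
  nonnegB : 0 ≤ m
  startA : A 0 = a
  startB : B 0 = b
  endA : A l = g s
  endB : B m = g s
  memA : ∀ t ∈ Ioc 0 l, A t ∈ V
  memB : ∀ t ∈ Ioc 0 m, B t ∈ V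
  meet : ∀ t ∈ Icc 0 l, ∀ u ∈ Icc 0 m, A t = B u → t = l ∧ u = m
  meetA : ∀ t ∈ Icc 0 l, ∀ u ∈ Icc s 1, A t = g u → t = l
  meetB : ∀ t ∈ Icc 0 m, ∀ u ∈ Icc s 1, B t = g u → t = m

lemma IsTripod.symm {X : Type*} [MetricSpace X] {g : ℝ → X} {V : Set X} {a b : X} {A B : ℝ → X}
    {l m s : ℝ} (h : IsTripod g V a b A B l m s) : IsTripod g V b a B A m l s :=
  ⟨h.contB, h.contA, h.nonnegB, h.nonnegA, h.startB, h.startA, h.endB, h.endA, h.memB, h.memA,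
    fun t ht u hu htu => (h.meet u hu t ht htu.symm).symm, h.meetB, h.meetA⟩

/-- The path `A'` on `[0,l']` agrees with `A` on `[0,l]` up to some time, after which it stays in
`O`. -/
def IsModification {X : Type*} (O : Set X) (A : ℝ → X) (l : ℝ) (A' : ℝ → X) (l' : ℝ) : Prop :=
  ∃ τ, 0 ≤ τ ∧ τ ≤ l ∧ τ ≤ l' ∧ EqOn A A' (Icc 0 τ) ∧ ∀ t ∈ Icc τ l', A' t ∈ O

lemma IsModification.refl {X : Type*} {O : Set X} {A : ℝ → X} {l : ℝ} (hl : 0 ≤ l) (h : A l ∈ O) :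
    IsModification O A l A l :=
  ⟨l, hl, le_rfl, le_rfl, fun _ _ => rfl, fun t ht => by rwa [le_antisymm ht.2 ht.1]⟩

lemma IsModification.trans {X : Type*} {O : Set X} {A A' A'' : ℝ → X} {l l' l'' : ℝ}
    (h : IsModification O A l A' l') (h' : IsModification O A' l' A'' l'') :
    IsModification O A l A'' l'' := by
  obtain ⟨τ, h0, h1, h2, h3, h4⟩ := h
  obtain ⟨σ, k0, k1, k2, k3, k4⟩ := h'
  rcases le_total τ σ with hτ | hτ
  · refine ⟨τ, h0, h1, hτ.trans k2, fun t ht => (h3 ht).trans (k3 ⟨ht.1, ht.2.trans hτ⟩),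
      fun t ht => ?_⟩
    rcases le_total t σ with htσ | htσ
    · rw [← k3 ⟨h0.trans ht.1, htσ⟩]
      exact h4 t ⟨ht.1, htσ.trans k1⟩
    · exact k4 t ⟨htσ, ht.2⟩
  · exact ⟨σ, k0, hτ.trans h1, k2, fun t ht => (h3 ⟨ht.1, ht.2.trans hτ⟩).trans (k3 ht), k4⟩

lemma IsModification.mono {X : Type*} {O O' : Set X} {A A' : ℝ → X} {l l' : ℝ}
    (h : IsModification O A l A' l') (hO : O ⊆ O') : IsModification O' A l A' l' := by
  obtain ⟨τ, h0, h1, h2, h3, h4⟩ := h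
  exact ⟨τ, h0, h1, h2, h3, fun t ht => hO (h4 t ht)⟩

/-- Reroute a leg of a tripod along a shortcut `β` from the spine which first hits the legs at a
point of `A`; the other leg is prolonged along the spine. -/
lemma IsTripod.exists_reroute {X : Type*} [MetricSpace X] {g : ℝ → X} {V : Set X} {a b : X}
    {A B : ℝ → X} {l m s c : ℝ} (hg : IsSpine g V c) (hcs : c ≤ s) (hs1 : s < 1)
    (h : IsTripod g V a b A B l m s) {O : Set X} (hgO : ∀ u ∈ Ico s 1, g u ∈ O) {β : ℝ → X}
    (hβ : Continuous β) (hβO : ∀ w, β w ∈ O) (hβV : ∀ w, β w ∈ V) (hβs : ∀ w, β w ≠ g s)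
    (hβ0 : β 0 ∈ g '' Icc s 1) {u₁ τ : ℝ} (hu₁ : 0 ≤ u₁) (hτ : τ ∈ Icc 0 l) (hβτ : β u₁ = A τ)
    (hfirst : ∀ w ∈ Ico 0 u₁, β w ∉ A '' Icc 0 l ∪ B '' Icc 0 m) :
    ∃ A' B' l' m' s', s < s' ∧ s' < 1 ∧ (∃ w, β w = g s') ∧
      IsTripod g V a b A' B' l' m' s' ∧ IsModification O A l A' l' ∧
      IsModification O B m B' m' := by
  have hs0 : 0 ≤ s := hg.nonneg.trans hcs
  have hτl : τ < l := hτ.2.lt_of_ne fun hl => hβs u₁ (by rw [hβτ, hl, h.endA])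
  obtain ⟨u₀, ⟨hu₀, v, hv, hvβ⟩, hlast⟩ : ∃ u₀, IsGreatest (Icc 0 u₁ ∩ β ⁻¹' (g '' Icc s 1)) u₀ := by
    refine IsCompact.exists_isGreatest ?_ ⟨0, ⟨le_rfl, hu₁⟩, hβ0⟩
    exact isCompact_Icc.inter_right ((isCompact_Icc.image hg.cont).isClosed.preimage hβ)
  have hlast' : ∀ w ∈ Icc u₀ u₁, ∀ u ∈ Icc s 1, β w = g u → w = u₀ := fun w hw u hu hwu =>
    le_antisymm (hlast ⟨⟨hu₀.1.trans hw.1, hw.2⟩, u, hu, hwu.symm⟩) hw.1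
  have hsv : s < v := hv.1.lt_of_ne fun hs => hβs u₀ (by rw [← hvβ, hs])
  have hv1 : v < 1 := hv.2.lt_of_ne fun hv1 => hg.end_notMem (by rw [← hv1, hvβ]; exact hβV u₀)
  have hinj : ∀ x ∈ Icc s 1, ∀ y ∈ Icc s 1, g x = g y → x = y := fun x hx y hy hxy =>
    hg.inj ⟨hs0.trans hx.1, hx.2⟩ ⟨hs0.trans hy.1, hy.2⟩ hxy
  refine ⟨fun t => if t ≤ τ then A t else β (u₁ - (t - τ)),
    fun t => if t ≤ m then B t else g (s + (t - m)), τ + (u₁ - u₀), m + (v - s), v, hsv, hv1,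
    ⟨u₀, hvβ.symm⟩, ?_, ?_, ?_⟩
  · have hu := hu₀.2
    have hτ0 := hτ.1
    constructor
    · refine Continuous.if_le h.contA (by fun_prop) continuous_id continuous_const fun t ht => ?_
      simp [ht, hβτ]
    · refine Continuous.if_le h.contB (hg.cont.comp (by fun_prop)) continuous_id continuous_const
        fun t ht => ?_
      simp [ht, h.endB]
    · linarith
    · linarith [h.nonnegB]
    · simp [hτ0, h.startA]
    · simp [h.nonnegB, h.startB]
    · rcases hu.lt_or_eq with hlt | heq
      · simp [hlt, hvβ]
      · simp [← heq, ← hβτ, hvβ]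
    · simp [hsv]
    · intro t ht
      split_ifs with htτ
      · exact h.memA t ⟨ht.1, htτ.trans hτ.2⟩
      · exact hβV _
    · intro t ht
      split_ifs with htm
      · exact h.memB t ⟨ht.1, htm⟩
      · exact hg.mem _ ⟨by linarith, by linarith [ht.2]⟩
    · intro t ht u hu
      split_ifs with htτ hum hum
      · intro htu
        linarith [(h.meet t ⟨ht.1, htτ.trans hτ.2⟩ u ⟨hu.1, hum⟩ htu).1]
      · intro htu
        linarith [h.meetA t ⟨ht.1, htτ.trans hτ.2⟩ _ ⟨by linarith, by linarith [hu.2]⟩ htu]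
      · intro htu
        refine (hfirst (u₁ - (t - τ)) ⟨by linarith [ht.2, hu₀.1], by linarith⟩ (Or.inr ?_)).elim
        exact ⟨u, ⟨hu.1, hum⟩, htu.symm⟩
      · intro htu
        have hmem : s + (u - m) ∈ Icc s 1 := ⟨by linarith, by linarith [hu.2]⟩
        have h1 := hlast' (u₁ - (t - τ)) ⟨by linarith [ht.2], by linarith⟩ _ hmem htu
        rw [h1, ← hvβ] at htu
        have h2 := hinj _ hv _ hmem htu
        exact ⟨by linarith, by linarith⟩
    · intro t ht u hu
      have hus : u ∈ Icc s 1 := ⟨by linarith [hu.1], hu.2⟩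
      split_ifs with htτ
      · intro htu
        linarith [h.meetA t ⟨ht.1, htτ.trans hτ.2⟩ u hus htu]
      · intro htu
        linarith [hlast' (u₁ - (t - τ)) ⟨by linarith [ht.2], by linarith⟩ _ hus htu]
    · intro t ht u hu
      have hus : u ∈ Icc s 1 := ⟨by linarith [hu.1], hu.2⟩
      split_ifs with htm
      · intro htu
        have h1 := h.meetB t ⟨ht.1, htm⟩ u hus htu
        rw [h1, h.endB] at htu
        linarith [hinj _ ⟨le_rfl, hs1.le⟩ _ hus htu, hu.1]
      · intro htu
        linarith [hinj _ ⟨by linarith, by linarith [ht.2]⟩ _ hus htu, hu.1, ht.2]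
  · refine ⟨τ, hτ.1, hτ.2, by linarith [hu₀.2], fun t ht => ?_, fun t ht => ?_⟩
    · simp [ht.2]
    · rcases ht.1.eq_or_lt with rfl | hlt
      · simpa [← hβτ] using hβO u₁
      · simpa [not_le.2 hlt] using hβO _
  · refine ⟨m, h.nonnegB, le_rfl, by linarith, fun t ht => ?_, fun t ht => ?_⟩
    · simp [ht.2]
    · rcases ht.1.eq_or_lt with rfl | hlt
      · simpa [h.endB] using hgO s ⟨le_rfl, hs1⟩
      · simpa [not_le.2 hlt] using hgO _ ⟨by linarith, by linarith [ht.2]⟩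

/-- The union of the largest balls inside `V` centred at the points of the spine after time `s`. -/
def spineNhd {X : Type*} [MetricSpace X] (g : ℝ → X) (V : Set X) (s : ℝ) : Set X :=
  ⋃ u ∈ Ico s 1, ball (g u) (infDist (g u) Vᶜ)

lemma spineNhd_anti {X : Type*} [MetricSpace X] {g : ℝ → X} {V : Set X} {s s' : ℝ} (h : s ≤ s') :
    spineNhd g V s' ⊆ spineNhd g V s :=
  biUnion_subset_biUnion_left (Ico_subset_Ico_left h)

lemma spineNhd_subset {X : Type*} [MetricSpace X] {g : ℝ → X} {V : Set X} {s : ℝ} :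
    spineNhd g V s ⊆ V :=
  iUnion₂_subset fun _ _ => ball_infDist_compl_subset

namespace IsSpine

variable {X : Type*} [MetricSpace X] {g : ℝ → X} {V : Set X} {c : ℝ}

lemma infDist_pos (hg : IsSpine g V c) {u : ℝ} (hu : u ∈ Ico c 1) : 0 < infDist (g u) Vᶜ :=
  (hg.isOpen.isClosed_compl.notMem_iff_infDist_pos ⟨g 1, hg.end_notMem⟩).1
    (fun h => h (hg.mem u hu))

lemma mem_spineNhd (hg : IsSpine g V c) {s u : ℝ} (hcs : c ≤ s) (hu : u ∈ Ico s 1) :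
    g u ∈ spineNhd g V s :=
  mem_iUnion₂.2 ⟨u, hu, mem_ball_self (hg.infDist_pos ⟨hcs.trans hu.1, hu.2⟩)⟩

lemma exists_spineNhd_subset (hg : IsSpine g V c) {ε : ℝ} (hε : 0 < ε) :
    ∃ σ < 1, spineNhd g V σ ⊆ ball (g 1) ε := by
  obtain ⟨δ, hδ, h⟩ := Metric.continuousAt_iff.1 hg.cont.continuousAt (ε / 2) (half_pos hε)
  refine ⟨1 - δ / 2, by linarith, fun x hx => ?_⟩
  obtain ⟨u, hu, hxu⟩ := mem_iUnion₂.1 hx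
  have h1 : dist (g u) (g 1) < ε / 2 := h (by
    rw [Real.dist_eq, abs_of_nonpos (by linarith [hu.2])]; linarith [hu.1])
  have h2 : infDist (g u) Vᶜ ≤ dist (g u) (g 1) := infDist_le_dist_of_mem hg.end_notMem
  have h3 := mem_ball.1 hxu
  rw [mem_ball]
  linarith [dist_triangle x (g u) (g 1)]

end IsSpine

/-- The branch point of a tripod can be moved forward along the spine by a definite amount. -/
lemma IsTripod.exists_step {X : Type*} [MetricSpace X] [ProperSpace X] {L : ℝ} (hL : 1 ≤ L)
    (hX : IsALC L X) {g : ℝ → X} {V : Set X} {a b : X} {A B : ℝ → X} {l m s c : ℝ}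
    (hg : IsSpine g V c) (ha : a ∉ V) (hcs : c ≤ s) (hs1 : s < 1)
    (h : IsTripod g V a b A B l m s) :
    ∃ A' B' l' m' s', s < s' ∧ s' < 1 ∧
      infDist (g s) Vᶜ / (4 * L ^ 2) < dist (g s') (g s) ∧
      IsTripod g V a b A' B' l' m' s' ∧ IsModification (spineNhd g V s) A l A' l' ∧
      IsModification (spineNhd g V s) B m B' m' := by
  have hρ := hg.infDist_pos ⟨hcs, hs1⟩
  set ρ := infDist (g s) Vᶜ with hρdef
  have hρe : ∀ x ∉ V, ρ ≤ dist x (g s) := fun x hx => by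
    rw [dist_comm]; exact infDist_le_dist_of_mem hx
  have hL0 : 0 < L := by linarith
  have hR : 3 / 4 * (ρ / L) ≤ ρ := by
    have := div_le_self hρ.le hL
    have : 0 < ρ / L := by positivity
    linarith
  have hR0 : 0 ≤ 3 / 4 * (ρ / L) := by positivity
  obtain ⟨v, hv, hvd⟩ : ∃ v ∈ Icc s 1, dist (g v) (g s) = 3 / 4 * (ρ / L) :=
    intermediate_value_Icc hs1.le (hg.cont.dist continuous_const).continuousOn
      ⟨by simpa using hR0, hR.trans (hρe _ hg.end_notMem)⟩
  obtain ⟨t, ht, htd⟩ : ∃ t ∈ Icc 0 l, dist (A t) (g s) = 3 / 4 * (ρ / L) :=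
    intermediate_value_Icc' h.nonnegA (h.contA.dist continuous_const).continuousOn
      ⟨by simpa [h.endA] using hR0, by rw [h.startA]; exact hR.trans (hρe _ ha)⟩
  obtain ⟨p, hp⟩ := hX.joinedIn_annulus hL hρ (hρe _ hg.end_notMem) hvd htd
  have hpmem : ∀ w, p.extend w ∈ ball (g s) ρ \ closedBall (g s) (ρ / (4 * L ^ 2)) := fun w => by
    have : p.extend w ∈ range p := by rw [← Path.extend_range]; exact mem_range_self w
    obtain ⟨w', hw'⟩ := this
    rw [← hw']; exact hp w'
  have hcont := p.continuous_extend
  obtain ⟨u₁, ⟨hu₁, hhit⟩, hfirst⟩ :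
      ∃ u₁, IsLeast (Icc 0 1 ∩ p.extend ⁻¹' (A '' Icc 0 l ∪ B '' Icc 0 m)) u₁ := by
    refine IsCompact.exists_isLeast ?_ ⟨1, by simp, Or.inl ⟨t, ht, by simp⟩⟩
    exact isCompact_Icc.inter_right (((isCompact_Icc.image h.contA).union
      (isCompact_Icc.image h.contB)).isClosed.preimage hcont)
  have hfirst' : ∀ w ∈ Ico 0 u₁, p.extend w ∉ A '' Icc 0 l ∪ B '' Icc 0 m := fun w hw hmem =>
    absurd (hfirst ⟨⟨hw.1, hw.2.le.trans hu₁.2⟩, hmem⟩) (not_le.2 hw.2)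
  have hO : ∀ w, p.extend w ∈ spineNhd g V s := fun w =>
    mem_iUnion₂.2 ⟨s, ⟨le_rfl, hs1⟩, (hpmem w).1⟩
  have hne : ∀ w, p.extend w ≠ g s := fun w hw => (hpmem w).2 (by
    rw [hw]; exact mem_closedBall_self (by positivity))
  have hdist : ∀ s', (∃ w, p.extend w = g s') → ρ / (4 * L ^ 2) < dist (g s') (g s) := by
    rintro s' ⟨w, hw⟩
    rw [← hw]
    exact not_le.1 (hpmem w).2
  have h0 : p.extend 0 ∈ g '' Icc s 1 := ⟨v, hv, by simp⟩
  rcases hhit with ⟨τ, hτ, hτu⟩ | ⟨τ, hτ, hτu⟩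
  · obtain ⟨A', B', l', m', s', h1, h2, h3, h4, h5, h6⟩ := h.exists_reroute hg hcs hs1
      (fun u hu => hg.mem_spineNhd hcs hu) hcont hO (fun w => spineNhd_subset (hO w)) hne h0
      hu₁.1 hτ hτu.symm hfirst'
    exact ⟨A', B', l', m', s', h1, h2, hdist s' h3, h4, h5, h6⟩
  · obtain ⟨B', A', m', l', s', h1, h2, h3, h4, h5, h6⟩ := h.symm.exists_reroute hg hcs hs1
      (fun u hu => hg.mem_spineNhd hcs hu) hcont hO (fun w => spineNhd_subset (hO w)) hne h0
      hu₁.1 hτ hτu.symm (fun w hw => by rw [union_comm]; exact hfirst' w hw)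
    exact ⟨A', B', l', m', s', h1, h2, hdist s' h3, h4.symm, h6, h5⟩

/-- The branch point of a tripod can be moved arbitrarily close to the end of the spine. -/
lemma IsTripod.exists_reach {X : Type*} [MetricSpace X] [ProperSpace X] {L : ℝ} (hL : 1 ≤ L)
    (hX : IsALC L X) {g : ℝ → X} {V : Set X} {a b : X} {A B : ℝ → X} {l m s c : ℝ}
    (hg : IsSpine g V c) (ha : a ∉ V) (hcs : c ≤ s) (hs1 : s < 1)
    (h : IsTripod g V a b A B l m s) {σ : ℝ} (hσ : σ < 1) :
    ∃ A' B' l' m' s', σ ≤ s' ∧ s ≤ s' ∧ s' < 1 ∧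
      IsTripod g V a b A' B' l' m' s' ∧ IsModification (spineNhd g V s) A l A' l' ∧
      IsModification (spineNhd g V s) B m B' m' := by
  have hL0 : 0 < L := by linarith
  obtain ⟨δ, hδ, hstep⟩ : ∃ δ > 0, ∀ u v, c ≤ u → u ≤ σ → u ≤ v → v < 1 →
      infDist (g u) Vᶜ / (4 * L ^ 2) < dist (g v) (g u) → u + δ ≤ v := by
    rcases lt_or_ge σ c with hσc | hσc
    · exact ⟨1, one_pos, fun u v h1 h2 => absurd (h1.trans h2) (not_le.2 hσc)⟩
    obtain ⟨u₀, hu₀, hmin⟩ := isCompact_Icc.exists_isMinOn (nonempty_Icc.2 hσc)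
      ((continuous_infDist_pt Vᶜ).comp hg.cont).continuousOn
    have hpos := hg.infDist_pos (u := u₀) ⟨hu₀.1, hu₀.2.trans_lt hσ⟩
    have huc : UniformContinuousOn g (Icc c 1) :=
      isCompact_Icc.uniformContinuousOn_of_continuous hg.cont.continuousOn
    obtain ⟨δ, hδ, hδg⟩ := Metric.uniformContinuousOn_iff.1 huc
      (infDist (g u₀) Vᶜ / (4 * L ^ 2)) (by positivity)
    refine ⟨δ, hδ, fun u v h1 h2 h3 h4 h5 => ?_⟩
    by_contra! hlt
    have h6 := hδg v ⟨h1.trans h3, h4.le⟩ u ⟨h1, h3.trans h4.le⟩ (by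
      rw [Real.dist_eq, abs_of_nonneg (by linarith)]; linarith)
    have h7 : infDist (g u₀) Vᶜ ≤ infDist (g u) Vᶜ := hmin ⟨h1, h2⟩
    have h8 : infDist (g u₀) Vᶜ / (4 * L ^ 2) ≤ infDist (g u) Vᶜ / (4 * L ^ 2) := by gcongr
    linarith
  obtain ⟨N, hN⟩ := exists_nat_ge ((σ - s) / δ)
  rw [div_le_iff₀ hδ] at hN
  induction N generalizing A B l m s with
  | zero =>
    refine ⟨A, B, l, m, s, by simpa using hN, le_rfl, hs1, h, .refl h.nonnegA ?_,
      .refl h.nonnegB ?_⟩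
    · rw [h.endA]; exact hg.mem_spineNhd hcs ⟨le_rfl, hs1⟩
    · rw [h.endB]; exact hg.mem_spineNhd hcs ⟨le_rfl, hs1⟩
  | succ N ih =>
    rcases le_total σ s with hσs | hσs
    · refine ⟨A, B, l, m, s, hσs, le_rfl, hs1, h, .refl h.nonnegA ?_, .refl h.nonnegB ?_⟩
      · rw [h.endA]; exact hg.mem_spineNhd hcs ⟨le_rfl, hs1⟩
      · rw [h.endB]; exact hg.mem_spineNhd hcs ⟨le_rfl, hs1⟩
    obtain ⟨A', B', l', m', s', h1, h2, h3, h4, h5, h6⟩ := h.exists_step hL hX hg ha hcs hs1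
    have h7 := hstep s s' hcs hσs h1.le h2 h3
    obtain ⟨A'', B'', l'', m'', s'', k1, k2, k3, k4, k5, k6⟩ :=
      ih (hcs.trans h1.le) h2 h4 (by push_cast at hN; linarith)
    exact ⟨A'', B'', l'', m'', s'', k1, h1.le.trans k2, k3, k4,
      h5.trans (k5.mono (spineNhd_anti h1.le)), h6.trans (k6.mono (spineNhd_anti h1.le))⟩

lemma Continuous.joinedIn_image_Icc {X : Type*} [TopologicalSpace X] {A : ℝ → X}
    (hA : Continuous A) {p q : ℝ} (hpq : p ≤ q) : JoinedIn (A '' Icc p q) (A p) (A q) :=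
  (((convex_Icc p q).isPathConnected (nonempty_Icc.2 hpq)).image hA).joinedIn _
    (mem_image_of_mem _ (left_mem_Icc.2 hpq)) _ (mem_image_of_mem _ (right_mem_Icc.2 hpq))

/-- A sequence of successive modifications of a leg, in neighbourhoods shrinking to `e`, converges
to a path ending at `e`. -/
lemma exists_limit_leg {X : Type*} [MetricSpace X] {A : ℕ → ℝ → X} {l τ : ℕ → ℝ} {O : ℕ → Set X}
    {e : X} (hA : ∀ n, Continuous (A n)) (h0 : ∀ n, 0 ≤ τ n) (h1 : ∀ n, τ n ≤ l n)
    (h2 : ∀ n, τ n ≤ l (n + 1)) (h3 : ∀ n, EqOn (A n) (A (n + 1)) (Icc 0 (τ n)))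
    (h4 : ∀ n, ∀ t ∈ Icc (τ n) (l (n + 1)), A (n + 1) t ∈ O n)
    (h5 : ∀ n, ∀ t ∈ Icc 0 (l n), A n t ∉ O (n + 1))
    (h6 : ∀ n : ℕ, O (n + 1) ⊆ ball e (1 / ((n : ℝ) + 1))) :
    (∀ n, τ n < τ (n + 1)) ∧ Monotone (fun n => A n '' Icc 0 (τ n)) ∧
      JoinedIn (insert e (⋃ n, A n '' Icc 0 (τ n))) (A 0 0) e := by
  have hlt : ∀ n, τ n < τ (n + 1) := by
    intro n
    by_contra! hle
    refine h5 n (τ (n + 1)) ⟨h0 _, hle.trans (h1 n)⟩ ?_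
    rw [h3 n ⟨h0 _, hle⟩, h3 (n + 1) ⟨h0 _, le_rfl⟩]
    exact h4 (n + 1) _ ⟨le_rfl, h2 _⟩
  refine ⟨hlt, monotone_nat_of_le_succ fun n => ?_, ?_⟩
  · rintro _ ⟨t, ht, rfl⟩
    exact ⟨t, ⟨ht.1, ht.2.trans (hlt n).le⟩, (h3 n ht).symm⟩
  let x : ℕ → X := fun n => Nat.casesOn n (A 0 0) fun k => A k (τ k)
  let S : ℕ → Set X := fun n =>
    Nat.casesOn n (A 0 '' Icc 0 (τ 0)) fun k => A (k + 1) '' Icc (τ k) (τ (k + 1))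
  refine JoinedIn.of_seq (x := x) (S := S) (fun n => ?_) (fun n => ?_) (mem_insert _ _)
    (fun ε hε => ?_)
  · cases n with
    | zero => exact (hA 0).joinedIn_image_Icc (h0 0)
    | succ k =>
      have h := (hA (k + 1)).joinedIn_image_Icc (hlt k).le
      rw [← h3 k ⟨h0 k, le_rfl⟩] at h
      exact h
  · refine Subset.trans ?_ (subset_insert _ _)
    cases n with
    | zero => exact subset_iUnion (fun n => A n '' Icc 0 (τ n)) 0
    | succ k =>
      exact (image_mono (Icc_subset_Icc_left (h0 k))).trans
        (subset_iUnion (fun n => A n '' Icc 0 (τ n)) (k + 1))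
  · obtain ⟨N, hN⟩ := exists_nat_one_div_lt hε
    refine ⟨N + 2, fun n hn => ?_⟩
    obtain ⟨k, rfl⟩ : ∃ k, n = k + 2 := ⟨n - 2, by omega⟩
    rintro _ ⟨t, ht, rfl⟩
    have h := mem_ball.1 (h6 k (h4 (k + 1) t ⟨ht.1, ht.2.trans (h1 _)⟩))
    have hNk : (N : ℝ) ≤ k := by exact_mod_cast (by omega : N ≤ k)
    have : 1 / ((k : ℝ) + 1) ≤ 1 / ((N : ℝ) + 1) := by gcongr
    exact mem_ball.2 (by linarith)

/-- The legs of a tripod can be extended to the end of the spine, staying disjoint. -/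
lemma IsTripod.exists_limit {X : Type*} [MetricSpace X] [ProperSpace X] {L : ℝ} (hL : 1 ≤ L)
    (hX : IsALC L X) {g : ℝ → X} {V : Set X} {a b : X} {A B : ℝ → X} {l m s c : ℝ}
    (hg : IsSpine g V c) (ha : a ∉ V) (hae : a ≠ g 1) (hbe : b ≠ g 1) (hcs : c ≤ s)
    (hs1 : s < 1) (h : IsTripod g V a b A B l m s) :
    ∃ P Q : Set X, P ⊆ insert a V ∧ Q ⊆ insert b V ∧ Disjoint P Q ∧
      JoinedIn (insert (g 1) P) a (g 1) ∧ JoinedIn (insert (g 1) Q) b (g 1) := by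
  let T := {p : (ℝ → X) × (ℝ → X) × ℝ × ℝ × ℝ // c ≤ p.2.2.2.2 ∧ p.2.2.2.2 < 1 ∧
    IsTripod g V a b p.1 p.2.1 p.2.2.1 p.2.2.2.1 p.2.2.2.2}
  let O : T → Set X := fun p => spineNhd g V p.1.2.2.2.2
  have hnext : ∀ (n : ℕ) (p : T), ∃ q : T,
      O q ⊆ ball (g 1) (1 / ((n : ℝ) + 1)) ∧
      (∀ t ∈ Icc 0 p.1.2.2.1, p.1.1 t ∉ O q) ∧ (∀ t ∈ Icc 0 p.1.2.2.2.1, p.1.2.1 t ∉ O q) ∧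
      IsModification (O p) p.1.1 p.1.2.2.1 q.1.1 q.1.2.2.1 ∧
      IsModification (O p) p.1.2.1 p.1.2.2.2.1 q.1.2.1 q.1.2.2.2.1 := by
    rintro n ⟨⟨A, B, l, m, s⟩, hcs, hs1, h⟩
    dsimp only at hcs hs1 h ⊢
    have hclosed : IsClosed (A '' Icc 0 l ∪ B '' Icc 0 m) :=
      ((isCompact_Icc.image h.contA).union (isCompact_Icc.image h.contB)).isClosed
    have hnot : g 1 ∉ A '' Icc 0 l ∪ B '' Icc 0 m := by
      rintro (⟨t, ht, hte⟩ | ⟨t, ht, hte⟩)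
      · rcases ht.1.eq_or_lt with rfl | hpos
        · exact hae (h.startA.symm.trans hte)
        · exact hg.end_notMem (hte ▸ h.memA t ⟨hpos, ht.2⟩)
      · rcases ht.1.eq_or_lt with rfl | hpos
        · exact hbe (h.startB.symm.trans hte)
        · exact hg.end_notMem (hte ▸ h.memB t ⟨hpos, ht.2⟩)
    obtain ⟨ε, hε, hεK⟩ := Metric.isOpen_iff.1 hclosed.isOpen_compl _ hnot
    obtain ⟨σ, hσ, hσε⟩ := hg.exists_spineNhd_subset
      (lt_min hε (Nat.one_div_pos_of_nat (α := ℝ) (n := n)))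
    obtain ⟨A', B', l', m', s', k1, k2, k3, k4, k5, k6⟩ := h.exists_reach hL hX hg ha hcs hs1 hσ
    have hO := (spineNhd_anti (g := g) (V := V) k1).trans hσε
    refine ⟨⟨(A', B', l', m', s'), hcs.trans k2, k3, k4⟩,
      hO.trans (ball_subset_ball (min_le_right _ _)), fun t ht htO => ?_, fun t ht htO => ?_,
      k5, k6⟩
    · exact hεK (ball_subset_ball (min_le_left _ _) (hO htO)) (Or.inl ⟨t, ht, rfl⟩)
    · exact hεK (ball_subset_ball (min_le_left _ _) (hO htO)) (Or.inr ⟨t, ht, rfl⟩)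
  choose f hf using hnext
  let F : ℕ → T := fun n => Nat.rec ⟨(A, B, l, m, s), hcs, hs1, h⟩ (fun n p => f n p) n
  have hF : ∀ n, F (n + 1) = f n (F n) := fun _ => rfl
  have hT : ∀ n, IsTripod g V a b (F n).1.1 (F n).1.2.1 (F n).1.2.2.1 (F n).1.2.2.2.1
    (F n).1.2.2.2.2 := fun n => (F n).2.2.2
  have hF1 : ∀ n : ℕ, O (F (n + 1)) ⊆ ball (g 1) (1 / ((n : ℝ) + 1)) := fun n => (hf n (F n)).1
  choose τ a0 a1 a2 a3 a4 using fun n => (hf n (F n)).2.2.2.1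
  choose υ b0 b1 b2 b3 b4 using fun n => (hf n (F n)).2.2.2.2
  obtain ⟨ha_lt, ha_mono, haJ⟩ := exists_limit_leg (A := fun n => (F n).1.1) (fun n => (hT n).contA)
    a0 a1 a2 a3 a4 (fun n => (hf n (F n)).2.1) hF1
  obtain ⟨-, hb_mono, hbJ⟩ := exists_limit_leg (A := fun n => (F n).1.2.1) (fun n => (hT n).contB)
    b0 b1 b2 b3 b4 (fun n => (hf n (F n)).2.2.1) hF1
  refine ⟨_, _, ?_, ?_, ?_, (hT 0).startA ▸ haJ, (hT 0).startB ▸ hbJ⟩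
  · rintro _ ⟨_, ⟨n, rfl⟩, t, ht, rfl⟩
    rcases ht.1.eq_or_lt with rfl | hpos
    · exact Or.inl (hT n).startA
    · exact Or.inr ((hT n).memA t ⟨hpos, ht.2.trans (a1 n)⟩)
  · rintro _ ⟨_, ⟨n, rfl⟩, t, ht, rfl⟩
    rcases ht.1.eq_or_lt with rfl | hpos
    · exact Or.inl (hT n).startB
    · exact Or.inr ((hT n).memB t ⟨hpos, ht.2.trans (b1 n)⟩)
  · rw [disjoint_left]
    intro x hx hx'
    obtain ⟨n, hn⟩ := mem_iUnion.1 hx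
    obtain ⟨k, hk⟩ := mem_iUnion.1 hx'
    obtain ⟨t, ht, rfl⟩ := ha_mono (le_max_left n k) hn
    obtain ⟨u, hu, hut⟩ := hb_mono (le_max_right n k) hk
    set N := max n k
    have htu : (F (N + 1)).1.1 t = (F (N + 1)).1.2.1 u := by
      rw [← a3 N ht, ← b3 N hu]
      exact hut.symm
    have h1 := ((hT (N + 1)).meet t ⟨ht.1, ht.2.trans (a2 N)⟩ u ⟨hu.1, hu.2.trans (b2 N)⟩ htu).1
    have h2 := a1 (N + 1)
    have h3 := ha_lt N
    rw [← h1] at h2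
    linarith [ht.2]

/-- An initial piece of the arc `f` followed by an arc `c` which does not return to it. -/
lemma IsArc.exists_concat {X : Type*} [MetricSpace X] {f c : ℝ → X} (hf : IsArc f) (hc : IsArc c)
    {t₀ : ℝ} (ht0 : 0 ≤ t₀) (ht1 : t₀ < 1) (h0 : c 0 = f t₀)
    (hd : ∀ t ∈ Ioc 0 1, c t ∉ f '' Icc 0 t₀) :
    ∃ h : ℝ → X, IsArc h ∧ EqOn h f (Icc 0 t₀) ∧ h 1 = c 1 ∧ h '' Ico t₀ 1 ⊆ c '' Ico 0 1 := by
  have hpos : 0 < 1 - t₀ := by linarith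
  let h : ℝ → X := fun t => if t ≤ t₀ then f t else c ((t - t₀) / (1 - t₀))
  have hhf : EqOn h f (Icc 0 t₀) := fun t ht => if_pos ht.2
  have hhc : EqOn h (fun t => c ((t - t₀) / (1 - t₀))) (Icc t₀ 1) := by
    intro t ht
    rcases ht.1.eq_or_lt with rfl | hlt
    · simp [h, h0]
    · exact if_neg (not_le.2 hlt)
  have hmem : ∀ t ∈ Icc t₀ 1, (t - t₀) / (1 - t₀) ∈ Icc (0 : ℝ) 1 := fun t ht =>
    ⟨div_nonneg (by linarith [ht.1]) hpos.le, (div_le_one hpos).2 (by linarith [ht.2])⟩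
  have hne : ∀ t ∈ Icc 0 t₀, ∀ u ∈ Ioc t₀ 1, h t ≠ h u := by
    intro t ht u hu htu
    have hu' : u ∈ Icc t₀ 1 := ⟨hu.1.le, hu.2⟩
    rw [hhf ht, hhc hu'] at htu
    exact hd _ ⟨div_pos (by linarith [hu.1]) hpos, (hmem u hu').2⟩ ⟨t, ht, htu⟩
  refine ⟨h, ⟨?_, ?_⟩, hhf, ?_, ?_⟩
  · rw [← Icc_union_Icc_eq_Icc ht0 ht1.le]
    refine ContinuousOn.union_of_isClosed ?_ ?_ isClosed_Icc isClosed_Icc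
    · exact (hf.1.mono (Icc_subset_Icc_right ht1.le)).congr hhf
    · exact (hc.1.comp (by fun_prop) hmem).congr hhc
  · intro t ht u hu htu
    rcases le_or_gt t t₀ with h1 | h1 <;> rcases le_or_gt u t₀ with h2 | h2
    · rw [hhf ⟨ht.1, h1⟩, hhf ⟨hu.1, h2⟩] at htu
      exact hf.2 ht hu htu
    · exact (hne t ⟨ht.1, h1⟩ u ⟨h2, hu.2⟩ htu).elim
    · exact (hne u ⟨hu.1, h2⟩ t ⟨h1, ht.2⟩ htu.symm).elim
    · have h3 : t ∈ Icc t₀ 1 := ⟨h1.le, ht.2⟩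
      have h4 : u ∈ Icc t₀ 1 := ⟨h2.le, hu.2⟩
      rw [hhc h3, hhc h4] at htu
      have h5 := hc.2 (hmem t h3) (hmem u h4) htu
      rw [div_left_inj' hpos.ne'] at h5
      linarith
  · rw [hhc ⟨ht1.le, le_rfl⟩]
    simp [div_self hpos.ne']
  · rintro _ ⟨t, ht, rfl⟩
    have h3 : t ∈ Icc t₀ 1 := ⟨ht.1, ht.2.le⟩
    rw [hhc h3]
    exact ⟨_, ⟨(hmem t h3).1, (div_lt_one hpos).2 (by linarith [ht.2])⟩, rfl⟩

/-- Unzipping a tripod whose branch point is an interior point of the spine. -/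
lemma IsALC.exists_unzip {X : Type*} [MetricSpace X] [ProperSpace X] {L : ℝ} (hL : 1 ≤ L)
    (hX : IsALC L X) {g f A : ℝ → X} {U : Set X} {t₀ l c : ℝ} (hg : Continuous g)
    (hginj : InjOn g (Icc 0 1)) (hf : IsArc f) (hU : IsOpen U) (hgU : ∀ u ∈ Ico 0 1, g u ∈ U)
    (hfg : ∀ t ∈ Ico 0 1, ∀ u ∈ Icc 0 1, f t ≠ g u) (ht0 : 0 < t₀) (ht1 : t₀ < 1)
    (hc0 : 0 < c) (hc1 : c < 1) (hA : Continuous A) (hl : 0 ≤ l) (hA0 : A 0 = f t₀)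
    (hAl : A l = g c) (hAg : ∀ t ∈ Ico 0 l, ∀ u ∈ Icc 0 1, A t ≠ g u)
    (hAU : ∀ t ∈ Icc 0 l, A t ∈ U) (hAf : ∀ t ∈ Ioc 0 l, A t ∉ f '' Icc 0 t₀) :
    ∃ α γ : ℝ → X, IsArc α ∧ IsArc γ ∧
      γ '' Set.Ico 0 1 ⊆ U ∧
      γ 1 = g 1 ∧
      (∃ s₀ : ℝ, 0 < s₀ ∧ s₀ ≤ 1 ∧ Set.EqOn γ g (Set.Icc 0 s₀)) ∧
      (∃ t₀ : ℝ, 0 < t₀ ∧ t₀ < 1 ∧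
        Set.EqOn α f (Set.Icc 0 t₀) ∧
        α '' Set.Ico t₀ 1 ⊆ U ∧
        (α '' Set.Ico t₀ 1) ∩ (γ '' Set.Ico 0 1) = ∅ ∧
        α 1 = γ 1 ∧ γ 1 = g 1) := by
  obtain ⟨s₀, hs0, hsc⟩ := exists_between hc0
  have hs1 := hsc.trans hc1
  have h1mem : (1 : ℝ) ∈ Icc (0 : ℝ) 1 := ⟨zero_le_one, le_rfl⟩
  have hfg' : ∀ u ∈ Icc (0 : ℝ) 1, g u ∉ f '' Icc 0 t₀ := by
    rintro u hu ⟨t, ht, htu⟩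
    exact hfg t ⟨ht.1, ht.2.trans_lt ht1⟩ u hu htu
  have hgs : ∀ u ∈ Ioc s₀ 1, g u ∉ g '' Icc 0 s₀ := by
    rintro u hu ⟨t, ht, htu⟩
    have := hginj ⟨ht.1, ht.2.trans hs1.le⟩ ⟨hs0.le.trans hu.1.le, hu.2⟩ htu
    linarith [ht.2, hu.1]
  have hge : ∀ u ∈ Ico (0 : ℝ) 1, g u ≠ g 1 := fun u hu h =>
    hu.2.ne (hginj ⟨hu.1, hu.2.le⟩ h1mem h)
  let V := U \ (f '' Icc 0 t₀ ∪ g '' Icc 0 s₀ ∪ {g 1})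
  have hVopen : IsOpen V := by
    refine hU.sdiff (IsClosed.union (IsClosed.union ?_ ?_) isClosed_singleton)
    · exact (isCompact_Icc.image_of_continuousOn
        (hf.1.mono (Icc_subset_Icc_right ht1.le))).isClosed
    · exact (isCompact_Icc.image hg).isClosed
  have hgV : ∀ u ∈ Ioo s₀ 1, g u ∈ V := by
    intro u hu
    have hu0 := hs0.trans hu.1
    refine ⟨hgU u ⟨hu0.le, hu.2⟩, ?_⟩
    rintro ((h | h) | h)
    · exact hfg' u ⟨hu0.le, hu.2.le⟩ h
    · exact hgs u ⟨hu.1, hu.2.le⟩ h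
    · exact hge u ⟨hu0.le, hu.2⟩ h
  have hspine : IsSpine g V c := ⟨hg, hginj, hVopen, hc0.le,
    fun u hu => hgV u ⟨hsc.trans_le hu.1, hu.2⟩, fun h => h.2 (Or.inr rfl)⟩
  have hAg' : ∀ t ∈ Icc 0 l, ∀ u ∈ Icc (0 : ℝ) 1, A t = g u → t = l ∧ u = c := by
    intro t ht u hu htu
    have htl : t = l := by
      by_contra hne
      exact hAg t ⟨ht.1, ht.2.lt_of_ne hne⟩ u hu htu
    refine ⟨htl, ?_⟩
    rw [htl, hAl] at htu
    exact (hginj ⟨hc0.le, hc1.le⟩ hu htu).symm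
  have htripod : IsTripod g V (f t₀) (g s₀) A (fun t => g (s₀ + t)) l (c - s₀) c := by
    refine ⟨hA, by fun_prop, hl, by linarith, hA0, by simp, hAl, by simp, fun t ht => ?_,
      fun t ht => ?_, fun t ht u hu h => ?_, fun t ht u hu h => ?_, fun t ht u hu h => ?_⟩
    · refine ⟨hAU t ⟨ht.1.le, ht.2⟩, ?_⟩
      rintro ((h | ⟨u, hu, h⟩) | h)
      · exact hAf t ht h
      · linarith [(hAg' t ⟨ht.1.le, ht.2⟩ u ⟨hu.1, hu.2.trans hs1.le⟩ h.symm).2, hu.2]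
      · linarith [(hAg' t ⟨ht.1.le, ht.2⟩ 1 h1mem h).2]
    · exact hgV _ ⟨by linarith [ht.1], by linarith [ht.2]⟩
    · obtain ⟨h1, h2⟩ := hAg' t ht (s₀ + u) ⟨by linarith [hu.1], by linarith [hu.2]⟩ h
      exact ⟨h1, by linarith⟩
    · exact (hAg' t ht u ⟨hc0.le.trans hu.1, hu.2⟩ h).1
    · have := hginj ⟨by linarith [ht.1], by linarith [ht.2]⟩ ⟨hc0.le.trans hu.1, hu.2⟩ h
      linarith [ht.2, hu.1]
  have ht0mem : t₀ ∈ Ico (0 : ℝ) 1 := ⟨ht0.le, ht1⟩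
  have hs0mem : s₀ ∈ Ico (0 : ℝ) 1 := ⟨hs0.le, hs1⟩
  obtain ⟨P, Q, hP, hQ, hPQ, hJP, hJQ⟩ := htripod.exists_limit hL hX hspine
    (fun h => h.2 (Or.inl (Or.inl ⟨t₀, ⟨ht0.le, le_rfl⟩, rfl⟩))) (hfg t₀ ht0mem 1 h1mem)
    (hge s₀ hs0mem) le_rfl hc1
  obtain ⟨p, hp, hp0, hp1, hpP⟩ := hJP.exists_isArc (hfg t₀ ht0mem 1 h1mem)
  obtain ⟨q, hq, hq0, hq1, hqQ⟩ := hJQ.exists_isArc (hge s₀ hs0mem)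
  have h0mem : (0 : ℝ) ∈ Icc (0 : ℝ) 1 := ⟨le_rfl, zero_le_one⟩
  have hpP' : p '' Ico 0 1 ⊆ P := by
    rintro _ ⟨t, ht, rfl⟩
    refine (hpP ⟨t, ⟨ht.1, ht.2.le⟩, rfl⟩).resolve_left fun h => ?_
    exact ht.2.ne (hp.2 ⟨ht.1, ht.2.le⟩ h1mem (h.trans hp1.symm))
  have hqQ' : q '' Ico 0 1 ⊆ Q := by
    rintro _ ⟨t, ht, rfl⟩
    refine (hqQ ⟨t, ⟨ht.1, ht.2.le⟩, rfl⟩).resolve_left fun h => ?_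
    exact ht.2.ne (hq.2 ⟨ht.1, ht.2.le⟩ h1mem (h.trans hq1.symm))
  have hpV : ∀ t ∈ Ioc 0 1, p t = g 1 ∨ p t ∈ V := by
    intro t ht
    have htm : t ∈ Icc (0 : ℝ) 1 := ⟨ht.1.le, ht.2⟩
    refine (hpP ⟨t, htm, rfl⟩).imp id fun h => (hP h).resolve_left fun h => ?_
    exact ht.1.ne' (hp.2 htm h0mem (h.trans hp0.symm))
  have hqV : ∀ t ∈ Ioc 0 1, q t = g 1 ∨ q t ∈ V := by
    intro t ht
    have htm : t ∈ Icc (0 : ℝ) 1 := ⟨ht.1.le, ht.2⟩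
    refine (hqQ ⟨t, htm, rfl⟩).imp id fun h => (hQ h).resolve_left fun h => ?_
    exact ht.1.ne' (hq.2 htm h0mem (h.trans hq0.symm))
  obtain ⟨α, hα, hαf, hα1, hαp⟩ := hf.exists_concat hp ht0.le ht1 hp0 fun t ht => by
    rcases hpV t ht with h | h
    · rw [h]; exact hfg' 1 h1mem
    · exact fun h' => h.2 (Or.inl (Or.inl h'))
  obtain ⟨γ, hγ, hγg, hγ1, hγq⟩ := IsArc.exists_concat ⟨hg.continuousOn, hginj⟩ hq hs0.le hs1 hq0
    fun t ht => by
      rcases hqV t ht with h | h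
      · rw [h]; exact hgs 1 ⟨hs1, le_rfl⟩
      · exact fun h' => h.2 (Or.inl (Or.inr h'))
  have hγQ : ∀ t ∈ Ico 0 1, (t ∈ Icc 0 s₀ ∧ γ t = g t) ∨ γ t ∈ Q := by
    intro t ht
    rcases le_total t s₀ with h | h
    · exact Or.inl ⟨⟨ht.1, h⟩, hγg ⟨ht.1, h⟩⟩
    · exact Or.inr (hqQ' (hγq ⟨t, ⟨h, ht.2⟩, rfl⟩))
  refine ⟨α, γ, hα, hγ, ?_, hγ1.trans hq1, ⟨s₀, hs0, hs1.le, hγg⟩, t₀, ht0, ht1, hαf, ?_, ?_,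
    by rw [hα1, hγ1, hp1, hq1], hγ1.trans hq1⟩
  · rintro _ ⟨t, ht, rfl⟩
    rcases hγQ t ht with ⟨-, h⟩ | h
    · rw [h]; exact hgU t ht
    · rcases hQ h with h | h
      · rw [h]; exact hgU s₀ hs0mem
      · exact h.1
  · intro x hx
    rcases hP (hpP' (hαp hx)) with h | h
    · rw [h, ← hA0]; exact hAU 0 ⟨le_rfl, hl⟩
    · exact h.1
  · rw [← disjoint_iff_inter_eq_empty, disjoint_left]
    rintro x hx ⟨t, ht, rfl⟩
    have hxP := hpP' (hαp hx)
    rcases hγQ t ht with ⟨hts, h⟩ | h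
    · rw [h] at hxP
      rcases hP hxP with h | h
      · exact hfg t₀ ht0mem t ⟨ht.1, ht.2.le⟩ h.symm
      · exact h.2 (Or.inl (Or.inr ⟨t, hts, rfl⟩))
    · exact disjoint_left.1 hPQ hxP h

/-- If an arc `f` ends at the initial point of `g`, its end can be rerouted so as to reach `g` at an
interior point. -/
lemma IsALC.exists_shortcut {X : Type*} [MetricSpace X] [ProperSpace X] {L : ℝ} (hL : 1 ≤ L)
    (hX : IsALC L X) {g f : ℝ → X} {U : Set X} {t₀ : ℝ} (hg : Continuous g)
    (hginj : InjOn g (Icc 0 1)) (hf : Continuous f) (hfinj : InjOn f (Icc 0 1)) (hU : IsOpen U)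
    (hfg : ∀ t ∈ Ico 0 1, ∀ u ∈ Icc 0 1, f t ≠ g u) (ht0 : 0 < t₀) (ht1 : t₀ < 1)
    (hfU : ∀ t ∈ Icc t₀ 1, f t ∈ U) (hend : f 1 = g 0) :
    ∃ (A : ℝ → X) (l c : ℝ), 0 < c ∧ c < 1 ∧ Continuous A ∧ 0 ≤ l ∧ A 0 = f t₀ ∧ A l = g c ∧
      (∀ t ∈ Ico 0 l, ∀ u ∈ Icc 0 1, A t ≠ g u) ∧ (∀ t ∈ Icc 0 l, A t ∈ U) ∧
      ∀ t ∈ Ioc 0 l, A t ∉ f '' Icc 0 t₀ := by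
  have h0mem : (0 : ℝ) ∈ Icc (0 : ℝ) 1 := ⟨le_rfl, zero_le_one⟩
  have h1mem : (1 : ℝ) ∈ Icc (0 : ℝ) 1 := ⟨zero_le_one, le_rfl⟩
  have hff : ∀ t ∈ Ioc t₀ 1, f t ∉ f '' Icc 0 t₀ := by
    rintro t ht ⟨u, hu, htu⟩
    have := hfinj ⟨hu.1, hu.2.trans ht1.le⟩ ⟨ht0.le.trans ht.1.le, ht.2⟩ htu
    linarith [ht.1, hu.2]
  let V := U \ (f '' Icc 0 t₀ ∪ {g 1})
  have hVopen : IsOpen V :=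
    hU.sdiff ((isCompact_Icc.image hf).isClosed.union isClosed_singleton)
  have hqV : g 0 ∈ V := by
    rw [← hend]
    refine ⟨hfU 1 ⟨ht1.le, le_rfl⟩, ?_⟩
    rintro (h | h)
    · exact hff 1 ⟨ht1, le_rfl⟩ h
    · rw [mem_singleton_iff, hend] at h
      exact zero_ne_one (hginj h0mem h1mem h)
  have heV : g 1 ∉ V := fun h => h.2 (Or.inr rfl)
  have hρ : 0 < infDist (g 0) Vᶜ :=
    (hVopen.isClosed_compl.notMem_iff_infDist_pos ⟨g 1, heV⟩).1 (fun h => h hqV)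
  set ρ := infDist (g 0) Vᶜ with hρdef
  have hρe : ∀ x ∉ V, ρ ≤ dist x (g 0) := fun x hx => by
    rw [dist_comm]; exact infDist_le_dist_of_mem hx
  have hL0 : 0 < L := by linarith
  have hR : 3 / 4 * (ρ / L) ≤ ρ := by
    have := div_le_self hρ.le hL
    have : 0 < ρ / L := by positivity
    linarith
  have hR0 : 0 < 3 / 4 * (ρ / L) := by positivity
  obtain ⟨v, hv, hvd⟩ : ∃ v ∈ Icc 0 1, dist (g v) (g 0) = 3 / 4 * (ρ / L) :=
    intermediate_value_Icc zero_le_one (hg.dist continuous_const).continuousOn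
      ⟨by simpa using hR0.le, hR.trans (hρe _ heV)⟩
  obtain ⟨t₂, ht₂, htd⟩ : ∃ t ∈ Icc t₀ 1, dist (f t) (g 0) = 3 / 4 * (ρ / L) :=
    intermediate_value_Icc' ht1.le (hf.dist continuous_const).continuousOn
      ⟨by simpa [hend] using hR0.le, hR.trans (hρe _ fun h =>
        h.2 (Or.inl ⟨t₀, ⟨ht0.le, le_rfl⟩, rfl⟩))⟩
  have ht₂1 : t₂ < 1 := ht₂.2.lt_of_ne fun h => by
    rw [h, hend, dist_self] at htd
    linarith
  obtain ⟨p, hp⟩ := hX.joinedIn_annulus hL hρ (hρe _ heV) htd hvd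
  have hpmem : ∀ w, p.extend w ∈ ball (g 0) ρ \ closedBall (g 0) (ρ / (4 * L ^ 2)) := fun w => by
    have : p.extend w ∈ range p := by rw [← Path.extend_range]; exact mem_range_self w
    obtain ⟨w', hw'⟩ := this
    rw [← hw']; exact hp w'
  have hpV : ∀ w, p.extend w ∈ V := fun w => ball_infDist_compl_subset (hpmem w).1
  have hcont := p.continuous_extend
  obtain ⟨u₁, ⟨hu₁, c, hc, hcu⟩, hfirst⟩ :
      ∃ u₁, IsLeast (Icc 0 1 ∩ p.extend ⁻¹' (g '' Icc 0 1)) u₁ := by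
    refine IsCompact.exists_isLeast ?_ ⟨1, by simp, v, hv, by simp⟩
    exact isCompact_Icc.inter_right ((isCompact_Icc.image hg).isClosed.preimage hcont)
  have hc0 : c ≠ 0 := fun h => (hpmem u₁).2 (by
    rw [← hcu, h]; exact mem_closedBall_self (by positivity))
  have hc1 : c ≠ 1 := fun h => heV (by rw [← h, hcu]; exact hpV u₁)
  refine ⟨fun t => if t ≤ t₂ - t₀ then f (t₀ + t) else p.extend (t - (t₂ - t₀)), t₂ - t₀ + u₁, c,
    hc.1.lt_of_ne hc0.symm, hc.2.lt_of_ne hc1, ?_, by linarith [ht₂.1, hu₁.1], ?_, ?_, ?_, ?_, ?_⟩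
  · refine Continuous.if_le (hf.comp (by fun_prop)) (hcont.comp (by fun_prop)) continuous_id
      continuous_const fun t ht => ?_
    simp [ht]
  · simp [ht₂.1]
  · rcases hu₁.1.eq_or_lt with h | h
    · rw [← h] at hcu
      simp [← h, hcu]
    · simp [not_le.2 h, hcu]
  · intro t ht u hu
    dsimp only
    split_ifs with h
    · exact hfg _ ⟨by linarith [ht.1], by linarith⟩ u hu
    · intro htu
      have := hfirst ⟨⟨by linarith, by linarith [ht.2, hu₁.2]⟩, u, hu, htu.symm⟩
      linarith [ht.2]
  · intro t ht
    dsimp only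
    split_ifs with h
    · exact hfU _ ⟨by linarith [ht.1], by linarith⟩
    · exact (hpV _).1
  · intro t ht
    dsimp only
    split_ifs with h
    · exact hff _ ⟨by linarith [ht.1], by linarith⟩
    · exact fun h' => (hpV _).2 (Or.inl h')

/-- Unzipping tripods in an annularly linearly connected space. -/
theorem stmt10 {X : Type*} [MetricSpace X] [ProperSpace X]
    (L : ℝ) (hL : 1 ≤ L) (hALC : IsALC L X)
    (γ' : ℝ → X) (hγ' : IsArc γ')
    (U : Set X) (hUopen : IsOpen U) (hUarc : ArcConnected U)
    (hUγ : γ' '' Set.Ico 0 1 ⊆ U)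
    (α' : ℝ → X) (hα' : IsArc α')
    (hα'0 : α' 0 ∉ U)
    (hdisj : (α' '' Set.Ico 0 1) ∩ (γ' '' Set.Icc 0 1) = ∅)
    (hα'1 : α' 1 ∈ γ' '' Set.Icc 0 1 ∩ U) :
    ∃ α γ : ℝ → X, IsArc α ∧ IsArc γ ∧
      γ '' Set.Ico 0 1 ⊆ U ∧
      γ 1 = γ' 1 ∧
      (∃ s₀ : ℝ, 0 < s₀ ∧ s₀ ≤ 1 ∧ Set.EqOn γ γ' (Set.Icc 0 s₀)) ∧
      (∃ t₀ : ℝ, 0 < t₀ ∧ t₀ < 1 ∧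
        Set.EqOn α α' (Set.Icc 0 t₀) ∧
        α '' Set.Ico t₀ 1 ⊆ U ∧
        (α '' Set.Ico t₀ 1) ∩ (γ '' Set.Ico 0 1) = ∅ ∧
        α 1 = γ 1 ∧ γ 1 = γ' 1) := by
  have h0mem : (0 : ℝ) ∈ Icc (0 : ℝ) 1 := ⟨le_rfl, zero_le_one⟩
  have h1mem : (1 : ℝ) ∈ Icc (0 : ℝ) 1 := ⟨zero_le_one, le_rfl⟩
  have hclamp : ∀ h : ℝ → X, IsArc h → ∃ k : ℝ → X, Continuous k ∧ EqOn k h (Icc 0 1) ∧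
      InjOn k (Icc 0 1) := fun h hh => by
    have hk : EqOn (IccExtend zero_le_one ((Icc 0 1).domRestrict h)) h (Icc 0 1) := fun t ht => by
      rw [IccExtend_of_mem _ _ ht]; rfl
    exact ⟨_, hh.1.domRestrict.Icc_extend', hk, hh.2.congr hk.symm⟩
  obtain ⟨g, hg, hgγ, hginj⟩ := hclamp γ' hγ'
  obtain ⟨f, hf, hfα, hfinj⟩ := hclamp α' hα'
  have hgU : ∀ u ∈ Ico 0 1, g u ∈ U := fun u hu => by
    rw [hgγ ⟨hu.1, hu.2.le⟩]; exact hUγ ⟨u, hu, rfl⟩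
  have hfg : ∀ t ∈ Ico 0 1, ∀ u ∈ Icc 0 1, f t ≠ g u := fun t ht u hu h => by
    rw [hfα ⟨ht.1, ht.2.le⟩, hgγ hu] at h
    exact hdisj.subset ⟨⟨t, ht, rfl⟩, u, hu, h.symm⟩
  obtain ⟨⟨c, hc, hcα⟩, hU1⟩ := hα'1
  rw [← hgγ hc, ← hfα h1mem] at hcα
  rw [← hfα h1mem] at hU1
  obtain ⟨t₀, ht0, ht1, hfU⟩ : ∃ t₀ : ℝ, 0 < t₀ ∧ t₀ < 1 ∧ ∀ t ∈ Icc t₀ 1, f t ∈ U := by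
    obtain ⟨δ, hδ, h⟩ := Metric.isOpen_iff.1 (hUopen.preimage hf) 1 hU1
    refine ⟨max (1 / 2) (1 - δ / 2), by simp, max_lt (by norm_num) (by linarith),
      fun t ht => h ?_⟩
    rw [mem_ball, Real.dist_eq, abs_of_nonpos (by linarith [ht.2])]
    linarith [(le_max_right _ _).trans ht.1]
  have hff : ∀ t ∈ Ioc t₀ 1, f t ∉ f '' Icc 0 t₀ := by
    rintro t ht ⟨u, hu, htu⟩
    have := hfinj ⟨hu.1, hu.2.trans ht1.le⟩ ⟨ht0.le.trans ht.1.le, ht.2⟩ htu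
    linarith [ht.1, hu.2]
  rcases hc.2.eq_or_lt with rfl | hc1
  · refine ⟨f, g, ⟨hf.continuousOn, hfinj⟩, ⟨hg.continuousOn, hginj⟩, ?_, hgγ h1mem,
      ⟨1, one_pos, le_rfl, hgγ⟩, t₀, ht0, ht1, fun t ht => hfα ⟨ht.1, ht.2.trans ht1.le⟩, ?_, ?_,
      hcα.symm, hgγ h1mem⟩
    · rintro _ ⟨u, hu, rfl⟩
      exact hgU u hu
    · rintro _ ⟨t, ht, rfl⟩
      exact hfU t ⟨ht.1, ht.2.le⟩
    · rw [← disjoint_iff_inter_eq_empty, disjoint_left]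
      rintro _ ⟨t, ht, rfl⟩ ⟨u, hu, h⟩
      exact hfg t ⟨ht0.le.trans ht.1, ht.2⟩ u ⟨hu.1, hu.2.le⟩ h.symm
  · obtain ⟨A, l, c₁, hc₁, hc₁', hA, hl, hA0, hAl, hAg, hAU, hAf⟩ :
        ∃ (A : ℝ → X) (l c : ℝ), 0 < c ∧ c < 1 ∧ Continuous A ∧ 0 ≤ l ∧ A 0 = f t₀ ∧ A l = g c ∧
          (∀ t ∈ Ico 0 l, ∀ u ∈ Icc 0 1, A t ≠ g u) ∧ (∀ t ∈ Icc 0 l, A t ∈ U) ∧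
          ∀ t ∈ Ioc 0 l, A t ∉ f '' Icc 0 t₀ := by
      rcases hc.1.eq_or_lt with rfl | hc0
      · exact hALC.exists_shortcut hL hg hginj hf hfinj hUopen hfg ht0 ht1 hfU hcα.symm
      · exact ⟨fun t => f (t₀ + t), 1 - t₀, c, hc0, hc1, by fun_prop, by linarith, by simp,
          by simp [hcα], fun t ht => hfg _ ⟨by linarith [ht.1], by linarith [ht.2]⟩,
          fun t ht => hfU _ ⟨by linarith [ht.1], by linarith [ht.2]⟩,
          fun t ht => hff _ ⟨by linarith [ht.1], by linarith [ht.2]⟩⟩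
    obtain ⟨α, γ, h1, h2, h3, h4, ⟨s₀, h5, h6, h7⟩, t₁, h8, h9, h10, h11, h12, h13, h14⟩ :=
      hALC.exists_unzip hL hg hginj ⟨hf.continuousOn, hfinj⟩ hUopen hgU hfg ht0 ht1 hc₁ hc₁' hA hl
        hA0 hAl hAg hAU hAf
    exact ⟨α, γ, h1, h2, h3, h4.trans (hgγ h1mem),
      ⟨s₀, h5, h6, h7.trans (hgγ.mono (Icc_subset_Icc_right h6))⟩, t₁, h8, h9,
      h10.trans (hfα.mono (Icc_subset_Icc_right h9.le)), h11, h12, h13, h14.trans (hgγ h1mem)⟩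
end

section
/- (Stability of arcs under Hausdorff approximation by bounded turning sets.) Let Z be a proper metric space, X ⊆ Z a compact set, γ : [0,1] → X an arc, η > 0, and L ≥ 1. Then there exists ε > 0 with the following property: for every nonempty compact set Y ⊆ Z with Hausdorff distance d_H(X,Y) ≤ ε and with the L-bounded turning property, and for all points y ∈ B(γ(0),ε) ∩ Y and y' ∈ B(γ(1),ε) ∩ Y, there exists a continuous map c : [0,1] → Y with c(0) = y, c(1) = y', whose image is an arc, and such that sup_{t ∈ [0,1]} d(c(t), γ(t)) ≤ η. -/
open Set Metric

/-- A subset `Y` of a metric space has the `L`-bounded turning property if any two of its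
points lie in a compact connected subset of `Y` of diameter at most `L` times their
distance. -/
def BoundedTurning {Z : Type*} [MetricSpace Z] (L : ℝ) (Y : Set Z) : Prop :=
  ∀ y ∈ Y, ∀ y' ∈ Y, ∃ K : Set Z, K ⊆ Y ∧ IsCompact K ∧ IsConnected K ∧
    y ∈ K ∧ y' ∈ K ∧ Metric.diam K ≤ L * dist y y'

open Filter Topology

theorem IsPreconnected.exists_dist_le_chain {Z : Type*} [MetricSpace Z] {K : Set Z}
    (hK : IsPreconnected K) {δ : ℝ} (hδ : 0 < δ) {x y : Z} (hx : x ∈ K) (hy : y ∈ K) :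
    ∃ (n : ℕ) (f : ℕ → Z), f 0 = x ∧ (∀ i ≥ n, f i = y) ∧ (∀ i, f i ∈ K) ∧
      ∀ i, dist (f i) (f (i + 1)) ≤ δ := by
  have single : ∀ x ∈ K, ∀ y ∈ K, dist x y ≤ δ → ∃ (n : ℕ) (f : ℕ → Z), f 0 = x ∧
      (∀ i ≥ n, f i = y) ∧ (∀ i, f i ∈ K) ∧ ∀ i, dist (f i) (f (i + 1)) ≤ δ := by
    intro x hx y hy hxy
    refine ⟨1, fun i => if i = 0 then x else y, by simp, fun i hi => if_neg (by omega),
      fun i => ?_, fun i => ?_⟩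
    · dsimp only
      split_ifs <;> assumption
    · rcases eq_or_ne i 0 with rfl | h
      · simpa using hxy
      · simp [h, hδ.le]
  refine hK.induction₂' (fun x y => ∃ (n : ℕ) (f : ℕ → Z), f 0 = x ∧ (∀ i ≥ n, f i = y) ∧
    (∀ i, f i ∈ K) ∧ ∀ i, dist (f i) (f (i + 1)) ≤ δ) ?_ ?_ hx hy
  · intro x hx
    filter_upwards [self_mem_nhdsWithin, mem_nhdsWithin_of_mem_nhds (closedBall_mem_nhds x hδ)]
      with y hy hxy
    rw [mem_closedBall] at hxy
    exact ⟨single x hx y hy (dist_comm y x ▸ hxy), single y hy x hx hxy⟩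
  · rintro x y z - - - ⟨n, f, hf0, hfn, hfK, hfd⟩ ⟨m, g, hg0, hgm, hgK, hgd⟩
    refine ⟨n + m, fun i => if i ≤ n then f i else g (i - n), by simpa using hf0,
      fun i hi => ?_, fun i => ?_, fun i => ?_⟩
    · dsimp only
      split_ifs with h
      · obtain rfl : m = 0 := by omega
        rw [hfn i (by omega), ← hg0, hgm 0 le_rfl]
      · exact hgm _ (by omega)
    · dsimp only
      split_ifs
      exacts [hfK _, hgK _]
    · rcases lt_trichotomy i n with h | rfl | h
      · simpa [h.le, Nat.succ_le_of_lt h] using hfd i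
      · simpa [hfn i le_rfl, ← hg0] using hgd 0
      · have h₁ : ¬ i ≤ n := by omega
        have h₂ : ¬ i + 1 ≤ n := by omega
        simpa [h₁, h₂, Nat.sub_add_comm h.le] using hgd (i - n)

/-- In `W`, points at distance at most `ρ` are joined by `δ`-chains which stay within
`B * ρ` of their starting point and whose length only depends on `ρ` and `δ`. -/
def HasUniformChains (W : Type*) [MetricSpace W] (B : ℝ) : Prop :=
  ∀ ρ > 0, ∀ δ > 0, ∃ N > 0, ∀ x y : W, dist x y ≤ ρ → ∃ f : ℕ → W, f 0 = x ∧ f N = y ∧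
    (∀ i, dist (f i) x ≤ B * ρ) ∧ ∀ i, dist (f i) (f (i + 1)) ≤ δ

theorem hasUniformChains_of_chains {W : Type*} [MetricSpace W] [CompactSpace W] {L : ℝ}
    (hL : 1 ≤ L)
    (h : ∀ δ > 0, ∀ x y : W, ∃ (n : ℕ) (f : ℕ → W), f 0 = x ∧ (∀ i ≥ n, f i = y) ∧
      (∀ i, dist (f i) x ≤ L * dist x y) ∧ ∀ i, dist (f i) (f (i + 1)) ≤ δ) :
    HasUniformChains W (3 * L) := by
  intro ρ hρ δ hδ
  choose n f hf0 hfn hfb hfd using h δ hδ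
  obtain ⟨e, he, heδ, heρ⟩ : ∃ e > 0, e ≤ δ ∧ e ≤ ρ / 2 :=
    ⟨min δ (ρ / 2), by positivity, min_le_left _ _, min_le_right _ _⟩
  obtain ⟨T, -, hT, hcov⟩ := (isCompact_univ (X := W)).finite_cover_balls he
  obtain ⟨M, hM⟩ := ((hT.prod hT).image fun q : W × W => n q.1 q.2).bddAbove
  refine ⟨M + 2, by omega, fun x y hxy => ?_⟩
  have hnear : ∀ x : W, ∃ s ∈ T, dist x s ≤ e := fun x => by
    have := hcov (mem_univ x)
    simp only [mem_iUnion, mem_ball, exists_prop] at this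
    obtain ⟨s, hs, hd⟩ := this
    exact ⟨s, hs, hd.le⟩
  obtain ⟨s, hs, hxs⟩ := hnear x
  obtain ⟨t, ht, hyt⟩ := hnear y
  have hst : dist s t ≤ 2 * ρ := by
    have := dist_triangle4 s x y t
    rw [dist_comm s x] at this
    linarith
  have hend : ∀ i ≥ M, f s t i = t := fun i hi =>
    hfn s t i ((hM ⟨(s, t), ⟨hs, ht⟩, rfl⟩).trans hi)
  have hLρ : ρ ≤ L * ρ := le_mul_of_one_le_left hρ.le hL
  refine ⟨fun i => if i = 0 then x else if i < M + 2 then f s t (i - 1) else y, by simp,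
    by simp, fun i => ?_, fun i => ?_⟩
  · dsimp only
    split_ifs
    · rw [dist_self]; positivity
    · have h₁ := dist_triangle (f s t (i - 1)) s x
      have h₂ := hfb s t (i - 1)
      have h₃ : L * dist s t ≤ L * (2 * ρ) := by gcongr
      rw [dist_comm s x] at h₁
      linarith
    · rw [dist_comm]; linarith
  · rcases Nat.eq_zero_or_pos i with rfl | hi
    · simpa [hf0] using hxs.trans heδ
    have hi' : i ≠ 0 := hi.ne'
    rcases lt_trichotomy (i + 1) (M + 2) with h | h | h
    · have h₂ : i < M + 2 := by omega
      have := hfd s t (i - 1)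
      rw [Nat.sub_add_cancel hi] at this
      simpa [hi', h, h₂] using this
    · have h₂ : i < M + 2 := by omega
      have h₃ : ¬ i + 1 < M + 2 := by omega
      simp only [hi', h₂, h₃, if_true, if_false, Nat.add_eq_zero_iff, one_ne_zero, and_false]
      rw [hend _ (by omega), dist_comm]
      exact hyt.trans heδ
    · have h₂ : ¬ i < M + 2 := by omega
      have h₃ : ¬ i + 1 < M + 2 := by omega
      simp [hi', h₂, h₃, hδ.le]

theorem floor_le_floor_add_one {a b : ℝ} (h : |a - b| < 1) : ⌊a⌋₊ ≤ ⌊b⌋₊ + 1 := by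
  rw [← Nat.lt_succ_iff, Nat.floor_lt' (Nat.succ_ne_zero _)]
  push_cast
  linarith [(abs_lt.1 h).2, Nat.lt_floor_add_one b]

/-- Coarse chains can be refined to continuous paths. -/
theorem HasUniformChains.exists_path {W : Type*} [MetricSpace W] [CompleteSpace W] {B : ℝ}
    (h : HasUniformChains W B) {δ : ℝ} (hδ : 0 < δ) {F₀ : ℕ → W}
    (hF₀ : ∀ i, dist (F₀ i) (F₀ (i + 1)) ≤ δ) :
    ∃ q : ℝ → W, Continuous q ∧ (∀ n : ℕ, q n = F₀ n) ∧
      ∀ t, dist (q t) (F₀ ⌊t⌋₊) ≤ 2 * B * δ := by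
  have hδk : ∀ k : ℕ, 0 < δ / 2 ^ k := fun k => by positivity
  have step : ∀ k : ℕ, ∃ N : ℕ, 0 < N ∧ ∀ x y : W, ∃ f : ℕ → W, dist x y ≤ δ / 2 ^ k →
      f 0 = x ∧ f N = y ∧ (∀ i, dist (f i) x ≤ B * (δ / 2 ^ k)) ∧
      ∀ i, dist (f i) (f (i + 1)) ≤ δ / 2 ^ (k + 1) := by
    intro k
    obtain ⟨N, hN, hf⟩ := h _ (hδk k) _ (hδk (k + 1))
    refine ⟨N, hN, fun x y => ?_⟩
    by_cases hxy : dist x y ≤ δ / 2 ^ k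
    · obtain ⟨f, hf⟩ := hf x y hxy
      exact ⟨f, fun _ => hf⟩
    · exact ⟨fun _ => x, fun h => absurd h hxy⟩
  choose N hN f hf using step
  let F : ℕ → ℕ → W := fun k => Nat.rec F₀
    (fun k G i => f k (G (i / N k)) (G (i / N k + 1)) (i % N k)) k
  have hFs : ∀ k i, F (k + 1) i = f k (F k (i / N k)) (F k (i / N k + 1)) (i % N k) :=
    fun k i => rfl
  have hFd : ∀ k i, dist (F k i) (F k (i + 1)) ≤ δ / 2 ^ k := by
    intro k
    induction k with
    | zero => simpa [F] using hF₀
    | succ k ih =>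
      intro i
      obtain ⟨h0, hNk, -, hd⟩ := hf k _ _ (ih (i / N k))
      have hmod := Nat.mod_lt i (hN k)
      have hdiv := Nat.div_add_mod i (N k)
      have hlink := hd (i % N k)
      rcases (Nat.succ_le_of_lt hmod).lt_or_eq with hlt | heq
      · obtain ⟨h₁, h₂⟩ := (Nat.div_mod_unique (hN k) (a := i + 1) (d := i / N k)
          (c := i % N k + 1)).2 ⟨by omega, hlt⟩
        rw [hFs, hFs, h₁, h₂]
        exact hlink
      · obtain ⟨h₁, h₂⟩ := (Nat.div_mod_unique (hN k) (a := i + 1) (d := i / N k + 1)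
          (c := 0)).2 ⟨by rw [mul_add]; omega, hN k⟩
        rw [hFs, hFs, h₁, h₂, (hf k _ _ (ih (i / N k + 1))).1]
        rw [show i % N k + 1 = N k from heq, hNk] at hlink
        exact hlink
  let M : ℕ → ℕ := fun k => ∏ j ∈ Finset.range k, N j
  have hM : ∀ k, 0 < M k := fun k => Finset.prod_pos fun j _ => hN j
  have hMs : ∀ k, M (k + 1) = M k * N k := fun k => Finset.prod_range_succ _ _
  let q : ℕ → ℝ → W := fun k t => F k ⌊t * M k⌋₊
  have hq : ∀ t k, dist (q k t) (q (k + 1) t) ≤ 2 * B * δ / 2 / 2 ^ k := by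
    intro t k
    have hfl : ⌊t * M (k + 1)⌋₊ / N k = ⌊t * M k⌋₊ := by
      have hNk : (N k : ℝ) ≠ 0 := by exact_mod_cast (hN k).ne'
      rw [← Nat.floor_div_natCast, hMs, Nat.cast_mul, ← mul_assoc, mul_div_cancel_right₀ _ hNk]
    simp only [q]
    rw [hFs, hfl, dist_comm]
    refine ((hf k _ _ (hFd k _)).2.2.1 _).trans_eq ?_
    ring
  have hlim : ∀ t, ∃ z, Tendsto (fun k => q k t) atTop (𝓝 z) := fun t =>
    cauchySeq_tendsto_of_complete (cauchySeq_of_le_geometric_two (hq t))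
  choose Q hQ using hlim
  have hqQ : ∀ t k, dist (q k t) (Q t) ≤ 2 * B * δ / 2 ^ k := fun t =>
    dist_le_of_le_geometric_two_of_tendsto (hq t) (hQ t)
  refine ⟨Q, ?_, ?_, ?_⟩
  · rw [Metric.continuous_iff]
    intro t e he
    obtain ⟨k, hk⟩ : ∃ k : ℕ, (4 * B * δ + δ) / 2 ^ k < e :=
      ((tendsto_const_nhds.div_atTop (tendsto_pow_atTop_atTop_of_one_lt one_lt_two)).eventually
        (gt_mem_nhds he)).exists
    have hMk : (0 : ℝ) < M k := by exact_mod_cast hM k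
    refine ⟨1 / M k, by positivity, fun s hst => ?_⟩
    have hfl : dist (q k s) (q k t) ≤ δ / 2 ^ k := by
      have hlt : |s * M k - t * M k| < 1 := by
        rwa [← sub_mul, abs_mul, abs_of_pos hMk, ← lt_div_iff₀ hMk, ← Real.dist_eq]
      have h₁ := floor_le_floor_add_one hlt
      have h₂ := floor_le_floor_add_one ((abs_sub_comm _ _).trans_lt hlt)
      rcases (by omega : ⌊s * M k⌋₊ = ⌊t * M k⌋₊ ∨ ⌊s * M k⌋₊ = ⌊t * M k⌋₊ + 1 ∨
        ⌊t * M k⌋₊ = ⌊s * M k⌋₊ + 1) with h | h | h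
      · simp only [q, h, dist_self, (hδk k).le]
      · simp only [q, h]
        rw [dist_comm]
        exact hFd k _
      · simp only [q, h]
        exact hFd k _
    have h₁ := hqQ s k
    have h₂ := hqQ t k
    have h₃ := dist_triangle4 (Q s) (q k s) (q k t) (Q t)
    rw [dist_comm (Q s) (q k s)] at h₃
    refine lt_of_le_of_lt ?_ hk
    calc _ ≤ 2 * B * δ / 2 ^ k + δ / 2 ^ k + 2 * B * δ / 2 ^ k := by linarith
      _ = _ := by ring
  · intro n
    have hn : ∀ k, F k (n * M k) = F₀ n := by
      intro k
      induction k with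
      | zero => simp [M, F]
      | succ k ih =>
        rw [hFs, hMs, ← mul_assoc, Nat.mul_div_cancel _ (hN k), Nat.mul_mod_left,
          (hf k _ _ (hFd k _)).1, ih]
    refine tendsto_nhds_unique (hQ n) ?_
    have : ∀ k, q k n = F₀ n := fun k => by
      simp only [q]
      rw [← Nat.cast_mul, Nat.floor_natCast, hn]
    simp only [this]
    exact tendsto_const_nhds
  · intro t
    have := hqQ t 0
    rw [dist_comm]
    simpa [q, M, F] using this

/-- Every point between two points of a closed set of reals lies in the closure of a gap. -/
theorem exists_gap_endpoints {C : Set ℝ} (hC : IsClosed C) {a b t : ℝ} (ha : a ∈ C)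
    (hb : b ∈ C) (hat : a ≤ t) (htb : t ≤ b) :
    ∃ x ∈ C, ∃ y ∈ C, x ∈ Icc a t ∧ y ∈ Icc t b ∧ Disjoint (Ioo x y) C := by
  by_cases ht : t ∈ C
  · exact ⟨t, ht, t, ht, ⟨hat, le_rfl⟩, ⟨le_rfl, htb⟩, by simp⟩
  obtain ⟨x, hx, hx'⟩ := (isCompact_Icc.inter_left hC : IsCompact (C ∩ Icc a t)).exists_isGreatest
    ⟨a, ha, le_rfl, hat⟩
  obtain ⟨y, hy, hy'⟩ := (isCompact_Icc.inter_left hC : IsCompact (C ∩ Icc t b)).exists_isLeast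
    ⟨b, hb, htb, le_rfl⟩
  refine ⟨x, hx.1, y, hy.1, hx.2, hy.2, Set.disjoint_left.2 fun z hz hzC => ?_⟩
  rcases le_total z t with h | h
  · exact (hx' ⟨hzC, hx.2.1.trans hz.1.le, h⟩).not_gt hz.1
  · exact (hy' ⟨hzC, h, hz.2.le.trans hy.2.2⟩).not_gt hz.2

/-- A path `p` takes the same value at the two endpoints of each gap of `C`. -/
def ClosesGaps {Z : Type*} (p : ℝ → Z) (C : Set ℝ) : Prop :=
  ∀ a ∈ C, ∀ b ∈ C, a ≤ b → Disjoint (Ioo a b) C → p a = p b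

theorem ClosesGaps.sInter {Z : Type*} [MetricSpace Z] {p : ℝ → Z} (hp : Continuous p)
    {S : Set (Set ℝ)} (hS : S.Nonempty) (hchain : IsChain (· ⊆ ·) S)
    (hclosed : ∀ C ∈ S, IsClosed C) (hgap : ∀ C ∈ S, ClosesGaps p C) :
    ClosesGaps p (⋂₀ S) := by
  intro a ha b hb hab hdis
  by_contra hne
  have hlt : a < b := lt_of_le_of_ne hab fun h => hne (h ▸ rfl)
  obtain ⟨U, V, hU, hV, haU, hbV, hUV⟩ := t2_separation hne
  obtain ⟨e₁, he₁, h₁⟩ := Metric.isOpen_iff.1 (hU.preimage hp) a haU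
  obtain ⟨e₂, he₂, h₂⟩ := Metric.isOpen_iff.1 (hV.preimage hp) b hbV
  obtain ⟨e, he, hle⟩ : ∃ e > 0, e < e₁ ∧ e < e₂ ∧ 2 * e < b - a := by
    refine ⟨min (min e₁ e₂) (b - a) / 3, by have := sub_pos.2 hlt; positivity, ?_⟩
    have := min_le_left (min e₁ e₂) (b - a)
    have := min_le_right (min e₁ e₂) (b - a)
    have := min_le_left e₁ e₂
    have := min_le_right e₁ e₂
    have : 0 < min (min e₁ e₂) (b - a) := by have := sub_pos.2 hlt; positivity
    refine ⟨?_, ?_, ?_⟩ <;> linarith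
  have := hS.to_subtype
  obtain ⟨⟨C, hCS⟩, hC⟩ := (isCompact_Icc (a := a + e) (b := b - e)).elim_directed_cover
    (fun C : S => (C : Set ℝ)ᶜ) (fun C => (hclosed C C.2).isOpen_compl)
    (fun z hz => by
      by_contra hcon
      simp only [mem_iUnion, mem_compl_iff, not_exists, not_not] at hcon
      exact Set.disjoint_left.1 hdis (⟨by linarith [hz.1], by linarith [hz.2]⟩ : z ∈ Ioo a b)
        (fun C hC => hcon ⟨C, hC⟩))
    (fun C D => by
      rcases hchain.total C.2 D.2 with h | h
      · exact ⟨C, subset_rfl, compl_subset_compl.2 h⟩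
      · exact ⟨D, compl_subset_compl.2 h, subset_rfl⟩)
  obtain ⟨x, hx, y, hy, hxI, hyI, hxy⟩ := exists_gap_endpoints (hclosed C hCS) (t := a + e)
    (ha C hCS) (hb C hCS) (by linarith) (by linarith)
  have hyb : b - e < y := by
    by_contra! h
    exact hC ⟨hyI.1, h⟩ hy
  have hxU : p x ∈ U := h₁ (by
    rw [mem_ball, Real.dist_eq, abs_lt]; constructor <;> linarith [hxI.1, hxI.2])
  have hyV : p y ∈ V := h₂ (by
    rw [mem_ball, Real.dist_eq, abs_lt]; constructor <;> linarith [hyI.1, hyI.2])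
  rw [hgap C hCS x hx y hy (hxI.2.trans hyI.1) hxy] at hxU
  exact Set.disjoint_left.1 hUV hxU hyV

/-- There is a closed set of times closing gaps of `p` such that `p` only repeats a value
on the set at the endpoints of a gap. -/
theorem exists_minimal_closesGaps {Z : Type*} [MetricSpace Z] {p : ℝ → Z}
    (hp : Continuous p) :
    ∃ C : Set ℝ, IsClosed C ∧ 0 ∈ C ∧ 1 ∈ C ∧ ClosesGaps p C ∧
      ∀ a ∈ C, ∀ b ∈ C, a ≤ b → p a = p b → Disjoint (Ioo a b) C := by
  obtain ⟨C, hCI, ⟨hC, h0, h1, hgap⟩, hmin⟩ := zorn_superset_nonempty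
    {C : Set ℝ | IsClosed C ∧ 0 ∈ C ∧ 1 ∈ C ∧ ClosesGaps p C}
    (fun S hS hchain hne => ⟨⋂₀ S, ⟨isClosed_sInter fun C hC => (hS hC).1,
      fun C hC => (hS hC).2.1, fun C hC => (hS hC).2.2.1,
      ClosesGaps.sInter hp hne hchain (fun C hC => (hS hC).1) fun C hC => (hS hC).2.2.2⟩,
      fun C hC => sInter_subset_of_mem hC⟩)
    (Icc 0 1) ⟨isClosed_Icc, by simp, by simp, fun a ha b hb hab hdis => by
      rcases hab.eq_or_lt with rfl | h
      · rfl
      · exact absurd (⟨by linarith [ha.1], by linarith [hb.2]⟩ : (a + b) / 2 ∈ Icc (0 : ℝ) 1)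
          (Set.disjoint_left.1 hdis ⟨by linarith, by linarith⟩)⟩
  refine ⟨C, hC, h0, h1, hgap, fun a ha b hb hab hpab => ?_⟩
  refine Set.disjoint_right.2 fun z hz hzab => ?_
  refine (hmin (y := C \ Ioo a b) ⟨hC.sdiff isOpen_Ioo,
    ⟨h0, fun h => (hCI ha).1.not_gt h.1⟩, ⟨h1, fun h => (hCI hb).2.not_gt h.2⟩, ?_⟩
    sdiff_subset hz).2 hzab
  intro x hx y hy hxy hdis
  by_cases h : Disjoint (Ioo x y) C
  · exact hgap x hx.1 y hy.1 hxy h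
  obtain ⟨w, hw, hwC⟩ := Set.not_disjoint_iff.1 h
  have hwab : w ∈ Ioo a b := by
    by_contra hcon
    exact Set.disjoint_left.1 hdis hw ⟨hwC, hcon⟩
  have hxa : x = a := by
    refine le_antisymm ?_ ?_
    · by_contra! hlt
      exact hx.2 ⟨hlt, hw.1.trans hwab.2⟩
    · by_contra! hlt
      exact Set.disjoint_left.1 hdis ⟨hlt, hwab.1.trans hw.2⟩ ⟨ha, fun h => h.1.false⟩
  have hyb : y = b := by
    refine le_antisymm ?_ ?_
    · by_contra! hlt
      exact Set.disjoint_left.1 hdis ⟨hw.1.trans hwab.2, hlt⟩ ⟨hb, fun h => h.2.false⟩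
    · by_contra! hlt
      exact hy.2 ⟨hwab.1.trans hw.2, hlt⟩
  rw [hxa, hyb, hpab]

/-- Loop erasure: a path can be made constant along closed loops so that its fibres become
order-connected. -/
theorem exists_loop_erasure {Z : Type*} [MetricSpace Z] {p : ℝ → Z} (hp : Continuous p) :
    ∃ c : ℝ → Z, ContinuousOn c (Icc 0 1) ∧ c 0 = p 0 ∧ c 1 = p 1 ∧
      (∀ t ∈ Icc (0 : ℝ) 1, ∃ a ∈ Icc 0 t, ∃ b ∈ Icc t 1, c t = p a ∧ p a = p b) ∧
      ∀ s ∈ Icc (0 : ℝ) 1, ∀ u ∈ Icc (0 : ℝ) 1, ∀ t ∈ Icc s u, c s = c u → c t = c s := by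
  obtain ⟨C, hC, h0, h1, hgap, hinj⟩ := exists_minimal_closesGaps hp
  have key : ∀ t : ℝ, ∃ x y : ℝ, t ∈ Icc (0 : ℝ) 1 → x ∈ C ∧ y ∈ C ∧ x ∈ Icc 0 t ∧
      y ∈ Icc t 1 ∧ Disjoint (Ioo x y) C := by
    intro t
    by_cases ht : t ∈ Icc (0 : ℝ) 1
    · obtain ⟨x, hx, y, hy, h⟩ := exists_gap_endpoints hC h0 h1 ht.1 ht.2
      exact ⟨x, y, fun _ => ⟨hx, hy, h⟩⟩
    · exact ⟨0, 0, fun h => absurd h ht⟩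
  choose x y hxy using key
  have hpxy : ∀ t ∈ Icc (0 : ℝ) 1, p (x t) = p (y t) := fun t ht => by
    obtain ⟨hx, hy, hxI, hyI, hd⟩ := hxy t ht
    exact hgap _ hx _ hy (hxI.2.trans hyI.1) hd
  have below : ∀ t ∈ Icc (0 : ℝ) 1, ∀ w ∈ C, w < y t → w ≤ x t := fun t ht w hw hwy => by
    by_contra! h
    exact Set.disjoint_left.1 (hxy t ht).2.2.2.2 ⟨h, hwy⟩ hw
  have hmono : ∀ s ∈ Icc (0 : ℝ) 1, ∀ t ∈ Icc (0 : ℝ) 1, s ≤ t → x s ≤ x t := by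
    intro s hs t ht hst
    rcases hst.eq_or_lt with rfl | hlt
    · rfl
    · exact below t ht _ (hxy s hs).1 (((hxy s hs).2.2.1.2.trans_lt hlt).trans_le
        (hxy t ht).2.2.2.1.1)
  have hself : ∀ t ∈ Icc (0 : ℝ) 1, t ∈ C → p (x t) = p t := by
    intro t ht htC
    rcases (hxy t ht).2.2.2.1.1.eq_or_lt with h | h
    · rw [hpxy t ht, ← h]
    · rw [le_antisymm (hxy t ht).2.2.1.2 (below t ht t htC h)]
  have hbetween : ∀ t ∈ Icc (0 : ℝ) 1, t ∈ C → ∀ s ∈ Icc (0 : ℝ) 1,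
      ∃ r, |r - t| ≤ |s - t| ∧ p (x s) = p r := by
    intro t ht htC s hs
    obtain ⟨hx, hy, hxI, hyI, hd⟩ := hxy s hs
    rcases lt_trichotomy s t with h | rfl | h
    · refine ⟨y s, ?_, hpxy s hs⟩
      have : y s ≤ t := by
        by_contra! hlt
        linarith [below s hs t htC hlt, hxI.2]
      rw [abs_of_nonpos (by linarith), abs_of_nonpos (by linarith)]
      linarith [hyI.1]
    · exact ⟨s, le_rfl, hself s hs htC⟩
    · refine ⟨x s, ?_, rfl⟩
      have := below s hs t htC (h.trans_le hyI.1)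
      rw [abs_of_nonneg (by linarith), abs_of_nonneg (by linarith)]
      linarith [hxI.2]
  refine ⟨fun t => p (x t), ?_, hself 0 (by simp) h0, hself 1 (by simp) h1,
    fun t ht => ⟨x t, (hxy t ht).2.2.1, y t, (hxy t ht).2.2.2.1, rfl, hpxy t ht⟩, ?_⟩
  · intro t ht
    by_cases htC : t ∈ C
    · rw [Metric.continuousWithinAt_iff]
      intro e he
      obtain ⟨d, hd, hd'⟩ := Metric.continuous_iff.1 hp t e he
      refine ⟨d, hd, fun {s} hs hst => ?_⟩
      obtain ⟨r, hr, hpr⟩ := hbetween t ht htC s hs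
      simp only [hpr, hself t ht htC]
      exact hd' r (hr.trans_lt hst)
    · obtain ⟨hx, hy, hxI, hyI, hd⟩ := hxy t ht
      have hxt : x t < t := lt_of_le_of_ne hxI.2 fun h => htC (h ▸ hx)
      have hty : t < y t := lt_of_le_of_ne hyI.1 fun h => htC (h ▸ hy)
      refine (continuousWithinAt_const (b := p (x t))).congr_of_eventuallyEq ?_ rfl
      filter_upwards [self_mem_nhdsWithin, mem_nhdsWithin_of_mem_nhds (Ioo_mem_nhds hxt hty)]
        with s hs hsI
      have h₁ := below s hs _ hx (hsI.1.trans_le (hxy s hs).2.2.2.1.1)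
      have h₂ := below t ht _ (hxy s hs).1 ((hxy s hs).2.2.1.2.trans_lt hsI.2)
      simp only [le_antisymm h₂ h₁]
  · intro s hs u hu t ht hsu
    have htI : t ∈ Icc (0 : ℝ) 1 := ⟨hs.1.trans ht.1, ht.2.trans hu.2⟩
    have h₁ := hmono s hs t htI ht.1
    have h₂ := hmono t htI u hu ht.2
    have hd := hinj _ (hxy s hs).1 _ (hxy u hu).1 (h₁.trans h₂) hsu
    change p (x t) = p (x s)
    rcases h₁.eq_or_lt with h | h
    · rw [h]
    rcases h₂.eq_or_lt with h' | h'
    · exact (congrArg p h').trans hsu.symm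
    · exact absurd (hxy t htI).1 (Set.disjoint_left.1 hd ⟨h, h'⟩)
/-- A continuous map on the unit interval with order-connected fibres admits a continuous
real-valued function with the same fibres. -/
theorem exists_continuous_real_same_fibres {Z : Type*} [MetricSpace Z] {c : unitInterval → Z}
    (hc : Continuous c) (hfib : ∀ s t u, s ≤ t → t ≤ u → c s = c u → c t = c s) :
    ∃ w : unitInterval → ℝ, Continuous w ∧ Antitone w ∧ ∀ s t, w s = w t ↔ c s = c t := by
  let G : unitInterval → unitInterval → ℝ :=
    fun t x => sInf ((fun u : unitInterval => dist (c (u * t)) (c x)) '' univ)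
  have hG : Continuous (Function.uncurry G) :=
    isCompact_univ.continuous_sInf
      (f := fun (q : unitInterval × unitInterval) u => dist (c (u * q.1)) (c q.2))
      (by unfold Function.HasUncurry.uncurry; simp only [Function.hasUncurryInduction]; fun_prop)
  have hbdd : ∀ t x, BddBelow ((fun u : unitInterval => dist (c (u * t)) (c x)) '' univ) :=
    fun t x => ⟨0, by rintro _ ⟨u, -, rfl⟩; exact dist_nonneg⟩
  have hmul : ∀ a t : unitInterval, a ≤ t → ∃ v, v * t = a := by
    intro a t hat
    rcases eq_or_ne (t : ℝ) 0 with h | h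
    · refine ⟨1, Subtype.ext ?_⟩
      have : (a : ℝ) ≤ t := hat
      simpa [h] using (le_antisymm (this.trans h.le) a.2.1).symm
    · exact ⟨⟨a / t, div_nonneg a.2.1 t.2.1, div_le_one_of_le₀ hat t.2.1⟩,
        Subtype.ext (div_mul_cancel₀ _ h)⟩
  have hle : ∀ s t x, s ≤ t → G t x ≤ G s x := by
    intro s t x hst
    refine le_csInf (univ_nonempty.image _) ?_
    rintro _ ⟨u, -, rfl⟩
    obtain ⟨v, hv⟩ : ∃ v : unitInterval, v * t = u * s := by
      exact hmul _ _ (unitInterval.mul_le_right.trans hst)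
    exact csInf_le (hbdd t x) ⟨v, trivial, by simp only [hv]⟩
  have heq : ∀ s t x, s ≤ t → c s = c t → G s x ≤ G t x := by
    intro s t x hst hcst
    refine le_csInf (univ_nonempty.image _) ?_
    rintro _ ⟨u, -, rfl⟩
    rcases le_total (u * t) s with h | h
    · obtain ⟨v, hv⟩ := hmul _ _ h
      exact csInf_le (hbdd s x) ⟨v, trivial, by simp only [hv]⟩
    · refine csInf_le (hbdd s x) ⟨1, trivial, ?_⟩
      simp only [one_mul, hfib s (u * t) t h unitInterval.mul_le_right hcst]
  have hlt : ∀ s t, s ≤ t → c s ≠ c t → G t t < G s t := by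
    intro s t hst hne
    have h0 : G t t ≤ 0 := csInf_le (hbdd t t) ⟨1, trivial, by simp⟩
    have hcont : Continuous fun u : unitInterval => dist (c (u * s)) (c t) := by fun_prop
    obtain ⟨u, -, hu⟩ := (isCompact_univ.image hcont).sInf_mem (univ_nonempty.image _)
    refine h0.trans_lt (lt_of_lt_of_eq (dist_pos.2 fun h => hne ?_) hu)
    exact (hfib _ s t unitInterval.mul_le_right hst h).trans h
  let pr : ℝ → unitInterval := projIcc 0 1 zero_le_one
  have hpr : Continuous pr := continuous_projIcc
  let w : unitInterval → ℝ := fun t => ∫ x in (0 : ℝ)..1, G t (pr x)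
  have hGc : ∀ t, Continuous fun x => G t (pr x) := fun t =>
    hG.comp (continuous_const.prodMk hpr)
  have hw : Continuous w :=
    intervalIntegral.continuous_parametric_intervalIntegral_of_continuous'
      (f := fun t x => G t (pr x))
      (hG.comp (continuous_fst.prodMk (hpr.comp continuous_snd))) 0 1
  have hanti : Antitone w := fun s t hst =>
    intervalIntegral.integral_mono_on zero_le_one ((hGc t).intervalIntegrable _ _)
      ((hGc s).intervalIntegrable _ _) fun x _ => hle s t (pr x) hst
  have hstrict : ∀ s t, s ≤ t → (w s = w t ↔ c s = c t) := by
    intro s t hst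
    constructor
    · intro hwst
      by_contra hne
      refine (intervalIntegral.integral_lt_integral_of_continuousOn_of_le_of_exists_lt zero_lt_one
        (hGc t).continuousOn (hGc s).continuousOn (fun x _ => hle s t (pr x) hst)
        ⟨t, t.2, ?_⟩).ne' hwst
      simpa only [pr, projIcc_val] using hlt s t hst hne
    · intro hcst
      refine intervalIntegral.integral_congr fun x _ =>
        le_antisymm (heq s t (pr x) hst hcst) (hle s t (pr x) hst)
  refine ⟨w, hw, hanti, fun s t => ?_⟩
  rcases le_total s t with h | h
  · exact hstrict s t h
  · rw [eq_comm, hstrict t s h, eq_comm]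

/-- A non-closed continuous map with order-connected fibres parametrizes an arc. -/
theorem exists_isArc_of_ordConnected_fibres {Z : Type*} [MetricSpace Z] {c : ℝ → Z}
    (hc : ContinuousOn c (Icc 0 1)) (hne : c 0 ≠ c 1)
    (hfib : ∀ s ∈ Icc (0 : ℝ) 1, ∀ u ∈ Icc (0 : ℝ) 1, ∀ t ∈ Icc s u, c s = c u → c t = c s) :
    ∃ φ : ℝ → Z, IsArc φ ∧ φ '' Icc 0 1 = c '' Icc 0 1 := by
  let c' : unitInterval → Z := fun t => c t
  have hc' : Continuous c' := continuousOn_iff_continuous_domRestrict.1 hc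
  obtain ⟨w, hw, hanti, hwc⟩ := exists_continuous_real_same_fibres hc'
    fun s t u hst htu h => hfib s s.2 u u.2 t ⟨hst, htu⟩ h
  have hpos : 0 < w 0 - w 1 := by
    refine sub_pos.2 (lt_of_le_of_ne (hanti zero_le_one) fun h => hne ?_)
    simpa only [c', Icc.coe_zero, Icc.coe_one] using ((hwc 1 0).1 h).symm
  let m : unitInterval → unitInterval := fun t => ⟨(w 0 - w t) / (w 0 - w 1),
    div_nonneg (sub_nonneg.2 (hanti t.2.1)) hpos.le,
    div_le_one_of_le₀ (sub_le_sub_left (hanti t.2.2) _) hpos.le⟩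
  have hm : Continuous m := by
    refine Continuous.subtype_mk ?_ _
    fun_prop
  have hmw : ∀ s t, m s = m t ↔ c' s = c' t := fun s t => by
    rw [← hwc, Subtype.ext_iff]
    simp only [m]
    rw [div_left_inj' hpos.ne']
    simp
  have hsurj : Function.Surjective m := by
    intro y
    have := mem_range_of_exists_le_of_exists_ge hm (c := y) ⟨0, ?_⟩ ⟨1, ?_⟩
    · exact this
    · exact Subtype.coe_le_coe.1 (by simpa [m] using y.2.1)
    · exact Subtype.coe_le_coe.1 (by simpa [m, div_self hpos.ne'] using y.2.2)
  obtain ⟨σ, hσ⟩ := hsurj.hasRightInverse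
  have hcomp : (c' ∘ σ) ∘ m = c' := funext fun t => (hmw _ _).1 (hσ (m t))
  have hcont : Continuous (c' ∘ σ) := by
    rw [(hm.isClosedMap.isQuotientMap hm hsurj).continuous_iff, hcomp]
    exact hc'
  refine ⟨IccExtend zero_le_one (c' ∘ σ), ⟨hcont.Icc_extend'.continuousOn, ?_⟩, ?_⟩
  · intro s hs t ht hst
    rw [IccExtend_of_mem _ _ hs, IccExtend_of_mem _ _ ht] at hst
    have := (hmw _ _).2 hst
    rw [hσ, hσ] at this
    exact congrArg Subtype.val this
  · ext z
    constructor
    · rintro ⟨t, ht, rfl⟩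
      rw [IccExtend_of_mem _ _ ht]
      exact ⟨σ ⟨t, ht⟩, (σ ⟨t, ht⟩).2, rfl⟩
    · rintro ⟨t, ht, rfl⟩
      refine ⟨m ⟨t, ht⟩, (m ⟨t, ht⟩).2, ?_⟩
      rw [IccExtend_val]
      exact congrFun hcomp ⟨t, ht⟩


/-- Compact bounded turning sets have uniform chains. -/
theorem BoundedTurning.hasUniformChains {Z : Type*} [MetricSpace Z] {Y : Set Z}
    (hY : IsCompact Y) {L : ℝ} (hL : 1 ≤ L) (hBT : BoundedTurning L Y) :
    HasUniformChains Y (3 * L) := by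
  have := isCompact_iff_compactSpace.1 hY
  refine hasUniformChains_of_chains hL fun δ hδ x y => ?_
  obtain ⟨K, hKY, hK, hKc, hxK, hyK, hdiam⟩ := hBT x x.2 y y.2
  obtain ⟨n, f, hf0, hfn, hfK, hfd⟩ := hKc.isPreconnected.exists_dist_le_chain hδ hxK hyK
  exact ⟨n, fun i => ⟨f i, hKY (hfK i)⟩, Subtype.ext hf0, fun i hi => Subtype.ext (hfn i hi),
    fun i => (dist_le_diam_of_mem hK.isBounded (hfK i) hxK).trans hdiam, hfd⟩

/-- Paths can be followed, up to a small error, inside bounded turning compact sets coming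
sufficiently close to them. -/
theorem exists_tracking_path {Z : Type*} [MetricSpace Z] {γ : ℝ → Z}
    (hγ : ContinuousOn γ (Icc 0 1)) {L : ℝ} (hL : 1 ≤ L) {δ : ℝ} (hδ : 0 < δ) :
    ∃ ε > 0, ∀ Y : Set Z, IsCompact Y → BoundedTurning L Y →
      (∀ t ∈ Icc (0 : ℝ) 1, ∃ z ∈ Y, dist z (γ t) ≤ ε) →
      ∀ y ∈ Y, dist y (γ 0) ≤ ε → ∀ y' ∈ Y, dist y' (γ 1) ≤ ε →
      ∃ p : ℝ → Z, Continuous p ∧ (∀ t, p t ∈ Y) ∧ p 0 = y ∧ p 1 = y' ∧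
        ∀ t ∈ Icc (0 : ℝ) 1, dist (p t) (γ t) ≤ δ := by
  obtain ⟨δ₀, hδ₀, hδ₀δ⟩ : ∃ δ₀ > 0, (6 * L + 1) * δ₀ = δ :=
    ⟨δ / (6 * L + 1), by positivity, mul_div_cancel₀ _ (by positivity)⟩
  obtain ⟨θ, hθ, hγθ⟩ := Metric.uniformContinuousOn_iff.1
    (isCompact_Icc.uniformContinuousOn_of_continuous hγ) (δ₀ / 2) (by positivity)
  obtain ⟨m, hm⟩ := exists_nat_one_div_lt hθ
  obtain ⟨M, hM, hMθ⟩ : ∃ M : ℕ, (0 : ℝ) < M ∧ (1 : ℝ) / M < θ :=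
    ⟨m + 1, by positivity, by exact_mod_cast hm⟩
  refine ⟨δ₀ / 4, by positivity, fun Y hY hBT hnear y hy hyγ y' hy' hyγ' => ?_⟩
  have hpt : ∀ i : ℕ, min ((i : ℝ) / M) 1 ∈ Icc (0 : ℝ) 1 := fun i =>
    ⟨le_min (by positivity) zero_le_one, min_le_right _ _⟩
  have hF : ∀ i : ℕ, ∃ z : Y, (i = 0 → z = ⟨y, hy⟩) ∧ (i = M → z = ⟨y', hy'⟩) ∧
      dist (z : Z) (γ (min ((i : ℝ) / M) 1)) ≤ δ₀ / 4 := by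
    intro i
    have hM0 : M ≠ 0 := by rintro rfl; simp at hM
    by_cases h0 : i = 0
    · exact ⟨⟨y, hy⟩, fun _ => rfl, fun h => absurd (h.symm.trans h0) hM0,
        by simpa [h0] using hyγ⟩
    by_cases h1 : i = M
    · refine ⟨⟨y', hy'⟩, fun h => absurd h h0, fun _ => rfl, ?_⟩
      simpa [h1, div_self hM.ne'] using hyγ'
    · obtain ⟨z, hz, hzγ⟩ := hnear _ (hpt i)
      exact ⟨⟨z, hz⟩, fun h => absurd h h0, fun h => absurd h h1, hzγ⟩
  choose F hF0 hFM hFγ using hF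
  have hlink : ∀ i, dist (F i) (F (i + 1)) ≤ δ₀ := by
    intro i
    have hclose : dist (min ((i : ℝ) / M) 1) (min (((i + 1 : ℕ) : ℝ) / M) 1) < θ := by
      refine lt_of_le_of_lt ?_ hMθ
      rw [Real.dist_eq]
      refine (abs_min_sub_min_le_max _ _ _ _).trans ?_
      rw [← sub_div, sub_self, abs_zero]
      push_cast
      rw [sub_add_cancel_left, abs_div, abs_neg, abs_one, abs_of_pos hM]
      exact (max_eq_left (by positivity)).le
    have h₁ := hγθ _ (hpt i) _ (hpt (i + 1)) hclose
    have h₂ := dist_triangle4 (F i : Z) (γ (min ((i : ℝ) / M) 1))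
      (γ (min (((i + 1 : ℕ) : ℝ) / M) 1)) (F (i + 1))
    have h₃ := hFγ (i + 1)
    rw [dist_comm] at h₃
    rw [Subtype.dist_eq]
    linarith [hFγ i]
  have := isCompact_iff_compactSpace.1 hY
  obtain ⟨q, hq, hqF, hqd⟩ := (hBT.hasUniformChains hY hL).exists_path hδ₀ hlink
  refine ⟨fun t => q (t * M), by fun_prop, fun t => (q _).2, ?_, ?_, fun t ht => ?_⟩
  · have := hqF 0
    rw [Nat.cast_zero] at this
    simp only [zero_mul, this, hF0 0 rfl]
  · simp only [one_mul, hqF, hFM M rfl]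
  · have htM : 0 ≤ t * M := mul_nonneg ht.1 hM.le
    have hfl : (⌊t * M⌋₊ : ℝ) / M ≤ t := (div_le_iff₀ hM).2 (Nat.floor_le htM)
    have hfu : t < (⌊t * M⌋₊ : ℝ) / M + 1 / M := by
      rw [← add_div, lt_div_iff₀ hM]
      exact Nat.lt_floor_add_one _
    have h₁ := hFγ ⌊t * M⌋₊
    have h₂ := hγθ _ (hpt ⌊t * M⌋₊) t ht (by
      rw [min_eq_left (hfl.trans ht.2), Real.dist_eq, abs_lt]
      constructor <;> linarith)
    have h₃ := hqd (t * M)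
    rw [Subtype.dist_eq] at h₃
    have h₄ := dist_triangle4 (q (t * M) : Z) (F ⌊t * M⌋₊)
      (γ (min ((⌊t * M⌋₊ : ℝ) / M) 1)) (γ t)
    linarith

theorem IsArc.exists_dist_le_imp_abs_sub_lt {Z : Type*} [MetricSpace Z] {γ : ℝ → Z}
    (hγ : IsArc γ) {θ : ℝ} (hθ : 0 < θ) :
    ∃ δ > 0, ∀ s ∈ Icc (0 : ℝ) 1, ∀ t ∈ Icc (0 : ℝ) 1, dist (γ s) (γ t) ≤ δ → |s - t| < θ := by
  let K : Set (ℝ × ℝ) := (Icc 0 1 ×ˢ Icc 0 1) ∩ {q | θ ≤ |q.1 - q.2|}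
  have hK : IsCompact K := (isCompact_Icc.prod isCompact_Icc).inter_right
    (isClosed_le continuous_const (by fun_prop))
  have hcont : ContinuousOn (fun q : ℝ × ℝ => dist (γ q.1) (γ q.2)) K :=
    continuous_dist.comp_continuousOn
      ((hγ.1.comp continuousOn_fst fun q hq => hq.1.1).prodMk
        (hγ.1.comp continuousOn_snd fun q hq => hq.1.2))
  rcases K.eq_empty_or_nonempty with hE | hne
  · refine ⟨1, one_pos, fun s hs t ht _ => ?_⟩
    by_contra! h
    exact hE.le (⟨⟨hs, ht⟩, h⟩ : (s, t) ∈ K)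
  · obtain ⟨q, hq, hmin⟩ := hK.exists_isMinOn hne hcont
    have hpos : 0 < dist (γ q.1) (γ q.2) := dist_pos.2 fun h => by
      have hθq : θ ≤ |q.1 - q.2| := hq.2
      rw [hγ.2 hq.1.1 hq.1.2 h, sub_self, abs_zero] at hθq
      exact hθq.not_gt hθ
    refine ⟨dist (γ q.1) (γ q.2) / 2, by positivity, fun s hs t ht hst => ?_⟩
    by_contra! h
    have := hmin (⟨⟨hs, ht⟩, h⟩ : (s, t) ∈ K)
    simp only [mem_ofPred_eq] at this
    linarith

/-- Stability of arcs under Hausdorff approximation by bounded turning sets. -/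
theorem stmt12 {Z : Type*} [MetricSpace Z] [ProperSpace Z]
    (X : Set Z) (hX : IsCompact X)
    (γ : ℝ → Z) (hγ : IsArc γ) (hγX : γ '' Set.Icc 0 1 ⊆ X)
    (η : ℝ) (hη : 0 < η) (L : ℝ) (hL : 1 ≤ L) :
    ∃ ε > 0, ∀ Y : Set Z, Y.Nonempty → IsCompact Y →
      Metric.hausdorffDist X Y ≤ ε → BoundedTurning L Y →
      ∀ y ∈ Metric.ball (γ 0) ε ∩ Y, ∀ y' ∈ Metric.ball (γ 1) ε ∩ Y,
        ∃ c : ℝ → Z, ContinuousOn c (Set.Icc 0 1) ∧ c 0 = y ∧ c 1 = y' ∧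
          c '' Set.Icc 0 1 ⊆ Y ∧
          (∃ φ : ℝ → Z, IsArc φ ∧ φ '' Set.Icc 0 1 = c '' Set.Icc 0 1) ∧
          ∀ t ∈ Set.Icc (0 : ℝ) 1, dist (c t) (γ t) ≤ η := by
  have h0 : (0 : ℝ) ∈ Icc (0 : ℝ) 1 := by simp
  have h1 : (1 : ℝ) ∈ Icc (0 : ℝ) 1 := by simp
  obtain ⟨θ, hθ, hγθ⟩ := Metric.uniformContinuousOn_iff.1
    (isCompact_Icc.uniformContinuousOn_of_continuous hγ.1) (η / 2) (by positivity)
  obtain ⟨δ₁, hδ₁, hinj⟩ := hγ.exists_dist_le_imp_abs_sub_lt (lt_min hθ one_pos)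
  obtain ⟨δ, hδ, hδη, hδδ₁⟩ : ∃ δ > 0, δ ≤ η / 2 ∧ δ ≤ δ₁ / 2 :=
    ⟨min (η / 2) (δ₁ / 2), by positivity, min_le_left _ _, min_le_right _ _⟩
  obtain ⟨ε, hε, hpath⟩ := exists_tracking_path hγ.1 hL hδ
  refine ⟨ε / 2, by positivity, fun Y hYne hY hXY hBT y hy y' hy' => ?_⟩
  have hfin : hausdorffEDist X Y ≠ ⊤ := hausdorffEDist_ne_top_of_nonempty_of_bounded
    ⟨γ 0, hγX ⟨0, h0, rfl⟩⟩ hYne hX.isBounded hY.isBounded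
  have hnear : ∀ t ∈ Icc (0 : ℝ) 1, ∃ z ∈ Y, dist z (γ t) ≤ ε := fun t ht => by
    obtain ⟨z, hz, hd⟩ := exists_dist_lt_of_hausdorffDist_lt (hγX ⟨t, ht, rfl⟩)
      (hXY.trans_lt (half_lt_self hε)) hfin
    exact ⟨z, hz, (dist_comm _ _).trans_le hd.le⟩
  obtain ⟨p, hp, hpY, rfl, rfl, hpγ⟩ := hpath Y hY hBT hnear
    y hy.2 ((mem_ball.1 hy.1).le.trans (half_le_self hε.le))
    y' hy'.2 ((mem_ball.1 hy'.1).le.trans (half_le_self hε.le))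
  have hclose : ∀ a ∈ Icc (0 : ℝ) 1, ∀ b ∈ Icc (0 : ℝ) 1, p a = p b →
      |a - b| < min θ 1 := by
    intro a ha b hb hab
    refine hinj a ha b hb ?_
    have h₁ := hpγ a ha
    rw [hab] at h₁
    linarith [dist_triangle_left (γ a) (γ b) (p b), hpγ b hb]
  obtain ⟨c, hc, hc0, hc1, hcp, hfib⟩ := exists_loop_erasure hp
  refine ⟨c, hc, hc0, hc1, ?_, exists_isArc_of_ordConnected_fibres hc ?_ hfib, ?_⟩
  · rintro _ ⟨t, ht, rfl⟩
    obtain ⟨a, -, b, -, hca, -⟩ := hcp t ht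
    exact hca ▸ hpY a
  · rw [hc0, hc1]
    intro h
    simpa using (hclose 0 h0 1 h1 h).trans_le (min_le_right _ _)
  · intro t ht
    obtain ⟨a, ha, b, hb, hca, hab⟩ := hcp t ht
    have haI : a ∈ Icc (0 : ℝ) 1 := ⟨ha.1, ha.2.trans ht.2⟩
    have hbI : b ∈ Icc (0 : ℝ) 1 := ⟨ht.1.trans hb.1, hb.2⟩
    have hlt := (hclose a haI b hbI hab).trans_le (min_le_left _ _)
    have hat := hγθ a haI t ht (by
      rw [Real.dist_eq, abs_lt]
      rw [abs_lt] at hlt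
      constructor <;> linarith [ha.2, hb.1])
    rw [hca]
    linarith [dist_triangle (p a) (γ a) (γ t), hpγ a haI]
end
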